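/- arXiv:1011.4571 — 4 statements merged into one kernel-verified Lean document; each statement's English description precedes it below -/
import Mathlib

section
/- (Uniqueness of regular solutions.) If (η₁, λ₁, r₁, s₁) and (η₂, λ₂, r₂, s₂) are two regular solutions on the same interval [1,T) with the same initial data at t = 1 (that is, η₁(1,·) = η₂(1,·), λ₁(1,·) = λ₂(1,·), r₁(1,·) = r₂(1,·), s₁(1,·) = s₂(1,·)), then η₁ = η₂, λ₁ = λ₂, r₁ = r₂ and s₁ = s₂ everywhere on [1,T) × ℝ. -/
open Real Set MeasureTheory

noncomputable section

/-- Partial derivative with respect to the time variable `t`. -/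
def pderivT (f : ℝ → ℝ → ℝ) (t x : ℝ) : ℝ := deriv (fun τ => f τ x) t

/-- Partial derivative with respect to the space variable `x`. -/
def pderivX (f : ℝ → ℝ → ℝ) (t x : ℝ) : ℝ := deriv (fun y => f t y) x

/-- The time interval `[1, T)` for a (possibly infinite) final time `T ∈ (1,∞]`. -/
def timeSlab (T : EReal) : Set ℝ := {t : ℝ | 1 ≤ t ∧ (t : EReal) < T}

/-- A regular solution of the plane-symmetric Einstein–stiff fluid equations in areal
coordinates, with cosmological constant `Λ`, on a time interval `J`:
continuously differentiable functions `η, λ, r, s`, 1-periodic in the space variable,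
with `r ≥ 0`, `s ≥ 0`, satisfying the evolution and constraint equations (E1)–(E5). -/
structure RegularSolution (Λ : ℝ) (J : Set ℝ) where
  η : ℝ → ℝ → ℝ
  lam : ℝ → ℝ → ℝ
  r : ℝ → ℝ → ℝ
  s : ℝ → ℝ → ℝ
  η_c1 : ContDiffOn ℝ 1 (fun p : ℝ × ℝ => η p.1 p.2) (J ×ˢ (Set.univ : Set ℝ))
  lam_c1 : ContDiffOn ℝ 1 (fun p : ℝ × ℝ => lam p.1 p.2) (J ×ˢ (Set.univ : Set ℝ))
  r_c1 : ContDiffOn ℝ 1 (fun p : ℝ × ℝ => r p.1 p.2) (J ×ˢ (Set.univ : Set ℝ))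
  s_c1 : ContDiffOn ℝ 1 (fun p : ℝ × ℝ => s p.1 p.2) (J ×ˢ (Set.univ : Set ℝ))
  η_per : ∀ t ∈ J, ∀ x : ℝ, η t (x + 1) = η t x
  lam_per : ∀ t ∈ J, ∀ x : ℝ, lam t (x + 1) = lam t x
  r_per : ∀ t ∈ J, ∀ x : ℝ, r t (x + 1) = r t x
  s_per : ∀ t ∈ J, ∀ x : ℝ, s t (x + 1) = s t x
  r_nonneg : ∀ t ∈ J, ∀ x : ℝ, 0 ≤ r t x
  s_nonneg : ∀ t ∈ J, ∀ x : ℝ, 0 ≤ s t x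
  eqE1 : ∀ t ∈ J, ∀ x : ℝ,
    Real.exp (-2 * η t x) * (2 * t * pderivT lam t x + 1) - Λ * t ^ 2
      = 4 * Real.pi * t ^ 2 * (r t x + s t x)
  eqE2 : ∀ t ∈ J, ∀ x : ℝ,
    Real.exp (-2 * η t x) * (2 * t * pderivT η t x - 1) + Λ * t ^ 2
      = 4 * Real.pi * t ^ 2 * (r t x + s t x)
  eqE3 : ∀ t ∈ J, ∀ x : ℝ,
    pderivX η t x = -(2 * Real.pi * t * Real.exp (lam t x + η t x) * (r t x - s t x))
  eqE4 : ∀ t ∈ J, ∀ x : ℝ,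
    pderivT r t x + Real.exp (η t x - lam t x) * pderivX r t x
      = -2 * (pderivT lam t x + Real.exp (η t x - lam t x) * pderivX η t x + 1 / t) * r t x
        - 2 / t * Real.sqrt (r t x * s t x)
  eqE5 : ∀ t ∈ J, ∀ x : ℝ,
    pderivT s t x - Real.exp (η t x - lam t x) * pderivX s t x
      = -2 * (pderivT lam t x - Real.exp (η t x - lam t x) * pderivX η t x + 1 / t) * s t x
        - 2 / t * Real.sqrt (r t x * s t x)

/-- A smooth regularization `√(y² + ε²)` of the absolute value. -/
def regAbs (ε y : ℝ) : ℝ := √(y ^ 2 + ε ^ 2)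

lemma regAbs_pos {ε : ℝ} (hε : 0 < ε) (y : ℝ) : 0 < regAbs ε y :=
  Real.sqrt_pos.2 (by positivity)

lemma abs_le_regAbs (ε y : ℝ) : |y| ≤ regAbs ε y :=
  Real.abs_le_sqrt (by nlinarith [sq_nonneg ε])

lemma le_regAbs {ε : ℝ} (y : ℝ) : ε ≤ regAbs ε y :=
  Real.le_sqrt_of_sq_le (by nlinarith [sq_nonneg y])

lemma regAbs_zero {ε : ℝ} (hε : 0 < ε) : regAbs ε 0 = ε := by
  simp [regAbs, Real.sqrt_sq hε.le]

lemma regAbs_le_add {ε : ℝ} (hε : 0 < ε) (y : ℝ) : regAbs ε y ≤ |y| + ε := by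
  refine Real.sqrt_le_iff.2 ⟨by positivity, ?_⟩
  nlinarith [sq_abs y, abs_nonneg y]

lemma contDiff_regAbs {ε : ℝ} (hε : 0 < ε) : ContDiff ℝ 1 (regAbs ε) := by
  unfold regAbs
  exact ContDiff.sqrt (by fun_prop) fun y => by positivity

lemma hasDerivAt_regAbs {ε : ℝ} (hε : 0 < ε) (y : ℝ) :
    HasDerivAt (regAbs ε) (y / regAbs ε y) y := by
  have h := ((hasDerivAt_pow 2 y).add_const (ε ^ 2)).sqrt (by positivity)
  refine h.congr_deriv ?_
  simp only [regAbs, Nat.cast_ofNat, Nat.add_one_sub_one, pow_one]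
  exact mul_div_mul_left _ _ two_ne_zero

lemma abs_div_regAbs_le_one {ε : ℝ} (hε : 0 < ε) (y : ℝ) : |y / regAbs ε y| ≤ 1 := by
  rw [abs_div, abs_of_pos (regAbs_pos hε y), div_le_one (regAbs_pos hε y)]
  exact abs_le_regAbs ε y

/-- The defect of the regularized sign, weighted by a square root, is uniformly small. -/
lemma one_sub_div_regAbs_mul_sqrt_le {ε y : ℝ} (hε : 0 < ε) (hy : 0 ≤ y) :
    (1 - y / regAbs ε y) * √y ≤ √ε := by
  set φ := regAbs ε y
  have hφ0 : 0 < φ := regAbs_pos hε y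
  have h1 : φ ≤ y + ε := by simpa [abs_of_nonneg hy] using regAbs_le_add hε y
  have h2 : y ≤ φ := by simpa [abs_of_nonneg hy] using abs_le_regAbs ε y
  have h3 : ε ≤ φ := le_regAbs y
  have h4 : 1 - y / φ ≤ ε / φ := by
    rw [one_sub_div hφ0.ne']
    gcongr
    linarith
  have hs : √φ * √φ = φ := Real.mul_self_sqrt hφ0.le
  have hs0 : 0 < √φ := Real.sqrt_pos.2 hφ0
  have he : √ε * √ε = ε := Real.mul_self_sqrt hε.le
  calc (1 - y / φ) * √y ≤ ε / φ * √φ := by gcongr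
    _ = √ε * (√ε / √φ) := by
      rw [div_mul_eq_mul_div, mul_div_assoc', he, div_eq_div_iff hφ0.ne' hs0.ne', mul_assoc, hs]
    _ ≤ √ε * 1 := by
      gcongr
      rw [div_le_one hs0]
      exact Real.sqrt_le_sqrt h3
    _ = √ε := mul_one _

lemma sqrt_sub_sqrt_le {a b : ℝ} (hb : 0 ≤ b) (hab : b ≤ a) : √a - √b ≤ √(a - b) := by
  have h : √a ≤ √b + √(a - b) := by
    refine Real.sqrt_le_iff.2 ⟨by positivity, ?_⟩
    nlinarith [Real.sq_sqrt hb, Real.sq_sqrt (sub_nonneg.2 hab),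
      mul_nonneg (Real.sqrt_nonneg b) (Real.sqrt_nonneg (a - b))]
  linarith

/-- Case of `neg_regSign_mul_sqrt_le` in which the differences have opposite signs. -/
lemma neg_regSign_mul_sqrt_le_of_opposite {ε B a₁ a₂ b₁ b₂ : ℝ} (hε : 0 < ε)
    (ha₂ : 0 ≤ a₂) (hb₁ : 0 ≤ b₁)
    (hB₁ : b₁ ≤ B) (hB₂ : a₂ ≤ B) (ha : a₂ ≤ a₁) (hb : b₁ ≤ b₂) :
    -((a₁ - a₂) / regAbs ε (a₁ - a₂) + (b₁ - b₂) / regAbs ε (b₁ - b₂)) *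
      (√a₁ * √b₁ - √a₂ * √b₂) ≤ √B * √ε := by
  have hb' : (b₁ - b₂) / regAbs ε (b₁ - b₂) = -((b₂ - b₁) / regAbs ε (b₂ - b₁)) := by
    have : regAbs ε (b₁ - b₂) = regAbs ε (b₂ - b₁) := by unfold regAbs; ring_nf
    rw [this]
    ring
  rw [hb']
  have ka := one_sub_div_regAbs_mul_sqrt_le hε (sub_nonneg.2 ha)
  have kb := one_sub_div_regAbs_mul_sqrt_le hε (sub_nonneg.2 hb)
  have la := abs_le.1 (abs_div_regAbs_le_one hε (a₁ - a₂))
  have lb := abs_le.1 (abs_div_regAbs_le_one hε (b₂ - b₁))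
  set σ := (a₁ - a₂) / regAbs ε (a₁ - a₂)
  set ρ := (b₂ - b₁) / regAbs ε (b₂ - b₁)
  have qa := sqrt_sub_sqrt_le ha₂ ha
  have qb := sqrt_sub_sqrt_le hb₁ hb
  have ma := Real.sqrt_le_sqrt ha
  have mb := Real.sqrt_le_sqrt hb
  have nb := Real.sqrt_le_sqrt hB₁
  have na := Real.sqrt_le_sqrt hB₂
  rcases le_total 0 (√a₁ * √b₁ - √a₂ * √b₂) with h | h
  · have hΔ : √a₁ * √b₁ - √a₂ * √b₂ ≤ √b₁ * √(a₁ - a₂) := by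
      nlinarith [Real.sqrt_nonneg a₂, Real.sqrt_nonneg b₁]
    calc -(σ + -ρ) * (√a₁ * √b₁ - √a₂ * √b₂)
        ≤ (1 - σ) * (√a₁ * √b₁ - √a₂ * √b₂) := by gcongr; linarith
      _ ≤ (1 - σ) * (√b₁ * √(a₁ - a₂)) := by gcongr; linarith
      _ = √b₁ * ((1 - σ) * √(a₁ - a₂)) := by ring
      _ ≤ √B * √ε :=
        mul_le_mul nb ka (mul_nonneg (by linarith) (Real.sqrt_nonneg _)) (Real.sqrt_nonneg _)
  · have hΔ : √a₂ * √b₂ - √a₁ * √b₁ ≤ √a₂ * √(b₂ - b₁) := by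
      nlinarith [Real.sqrt_nonneg a₂, Real.sqrt_nonneg b₁]
    have h' : 0 ≤ √a₂ * √b₂ - √a₁ * √b₁ := by linarith
    calc -(σ + -ρ) * (√a₁ * √b₁ - √a₂ * √b₂)
        = (σ - ρ) * (√a₂ * √b₂ - √a₁ * √b₁) := by ring
      _ ≤ (1 - ρ) * (√a₂ * √b₂ - √a₁ * √b₁) := by gcongr; linarith
      _ ≤ (1 - ρ) * (√a₂ * √(b₂ - b₁)) := by gcongr; linarith
      _ = √a₂ * ((1 - ρ) * √(b₂ - b₁)) := by ring
      _ ≤ √B * √ε :=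
        mul_le_mul na kb (mul_nonneg (by linarith) (Real.sqrt_nonneg _)) (Real.sqrt_nonneg _)

/-- The square-root coupling is dissipative in `L¹`, up to an error from the regularization. -/
lemma neg_regSign_mul_sqrt_le {ε B a₁ a₂ b₁ b₂ : ℝ} (hε : 0 < ε)
    (ha₁ : 0 ≤ a₁) (ha₂ : 0 ≤ a₂) (hb₁ : 0 ≤ b₁) (hb₂ : 0 ≤ b₂)
    (hA₁ : a₁ ≤ B) (hA₂ : a₂ ≤ B) (hB₁ : b₁ ≤ B) (hB₂ : b₂ ≤ B) :
    -((a₁ - a₂) / regAbs ε (a₁ - a₂) + (b₁ - b₂) / regAbs ε (b₁ - b₂)) *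
      (√a₁ * √b₁ - √a₂ * √b₂) ≤ √B * √ε := by
  have hR : 0 ≤ √B * √ε := by positivity
  have pa := regAbs_pos hε (a₁ - a₂)
  have pb := regAbs_pos hε (b₁ - b₂)
  rcases le_total a₂ a₁ with ha | ha <;> rcases le_total b₂ b₁ with hb | hb
  · refine le_trans ?_ hR
    have h1 : 0 ≤ (a₁ - a₂) / regAbs ε (a₁ - a₂) := div_nonneg (by linarith) pa.le
    have h2 : 0 ≤ (b₁ - b₂) / regAbs ε (b₁ - b₂) := div_nonneg (by linarith) pb.le
    have h3 : √a₂ * √b₂ ≤ √a₁ * √b₁ := by gcongr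
    exact mul_nonpos_of_nonpos_of_nonneg (by linarith) (by linarith)
  · exact neg_regSign_mul_sqrt_le_of_opposite hε ha₂ hb₁ hB₁ hA₂ ha hb
  · have := neg_regSign_mul_sqrt_le_of_opposite hε hb₂ ha₁ hA₁ hB₂ hb ha
    linarith
  · refine le_trans ?_ hR
    have h1 : (a₁ - a₂) / regAbs ε (a₁ - a₂) ≤ 0 :=
      div_nonpos_of_nonpos_of_nonneg (by linarith) pa.le
    have h2 : (b₁ - b₂) / regAbs ε (b₁ - b₂) ≤ 0 :=
      div_nonpos_of_nonpos_of_nonneg (by linarith) pb.le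
    have h3 : √a₁ * √b₁ ≤ √a₂ * √b₂ := by gcongr
    exact mul_nonpos_of_nonneg_of_nonpos (by linarith) (by linarith)

/-- `f` and `g` are bounded on `X`, with difference controlled by a multiple of `D`. -/
def LipPair {α : Type*} (X : Set α) (D f g : α → ℝ) : Prop :=
  ∃ N, 0 ≤ N ∧ ∀ p ∈ X, |f p| ≤ N ∧ |g p| ≤ N ∧ |f p - g p| ≤ N * D p

namespace LipPair

variable {α : Type*} {X : Set α} {D f g f' g' : α → ℝ}

lemma of_bound (hD : ∀ p ∈ X, 0 ≤ D p) (hf : ∃ N, ∀ p ∈ X, |f p| ≤ N) : LipPair X D f f := by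
  obtain ⟨N, hN⟩ := hf
  refine ⟨max N 0, le_max_right _ _, fun p hp =>
    ⟨(hN p hp).trans (le_max_left _ _), (hN p hp).trans (le_max_left _ _), ?_⟩⟩
  rw [sub_self, abs_zero]
  exact mul_nonneg (le_max_right _ _) (hD p hp)

lemma const (hD : ∀ p ∈ X, 0 ≤ D p) (c : ℝ) : LipPair X D (fun _ => c) (fun _ => c) :=
  of_bound hD ⟨|c|, fun _ _ => le_rfl⟩

lemma add (h : LipPair X D f g) (h' : LipPair X D f' g') :
    LipPair X D (fun p => f p + f' p) (fun p => g p + g' p) := by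
  obtain ⟨N, hN0, hN⟩ := h
  obtain ⟨M, hM0, hM⟩ := h'
  refine ⟨N + M, by positivity, fun p hp => ?_⟩
  obtain ⟨h1, h2, h3⟩ := hN p hp
  obtain ⟨k1, k2, k3⟩ := hM p hp
  refine ⟨(abs_add_le _ _).trans (by linarith), (abs_add_le _ _).trans (by linarith), ?_⟩
  calc |f p + f' p - (g p + g' p)| = |(f p - g p) + (f' p - g' p)| := by ring_nf
    _ ≤ |f p - g p| + |f' p - g' p| := abs_add_le _ _
    _ ≤ (N + M) * D p := by linarith

lemma neg (h : LipPair X D f g) : LipPair X D (fun p => -f p) (fun p => -g p) := by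
  obtain ⟨N, hN0, hN⟩ := h
  refine ⟨N, hN0, fun p hp => ?_⟩
  obtain ⟨h1, h2, h3⟩ := hN p hp
  refine ⟨by rwa [abs_neg], by rwa [abs_neg], ?_⟩
  rwa [neg_sub_neg, abs_sub_comm]

lemma sub (h : LipPair X D f g) (h' : LipPair X D f' g') :
    LipPair X D (fun p => f p - f' p) (fun p => g p - g' p) := by
  simpa only [sub_eq_add_neg] using h.add h'.neg

lemma mul (hD : ∀ p ∈ X, 0 ≤ D p) (h : LipPair X D f g) (h' : LipPair X D f' g') :
    LipPair X D (fun p => f p * f' p) (fun p => g p * g' p) := by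
  obtain ⟨N, hN0, hN⟩ := h
  obtain ⟨M, hM0, hM⟩ := h'
  have hNM : 0 ≤ N * M := by positivity
  refine ⟨2 * (N * M), by positivity, fun p hp => ?_⟩
  obtain ⟨h1, h2, h3⟩ := hN p hp
  obtain ⟨k1, k2, k3⟩ := hM p hp
  have hDp := hD p hp
  refine ⟨?_, ?_, ?_⟩
  · rw [abs_mul]
    nlinarith [mul_le_mul h1 k1 (abs_nonneg _) hN0]
  · rw [abs_mul]
    nlinarith [mul_le_mul h2 k2 (abs_nonneg _) hN0]
  · calc |f p * f' p - g p * g' p| = |f p * (f' p - g' p) + (f p - g p) * g' p| := by ring_nf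
      _ ≤ |f p| * |f' p - g' p| + |f p - g p| * |g' p| := by
        rw [← abs_mul, ← abs_mul]; exact abs_add_le _ _
      _ ≤ N * (M * D p) + N * D p * M := by gcongr
      _ = 2 * (N * M) * D p := by ring

lemma exp (hD : ∀ p ∈ X, 0 ≤ D p) (h : LipPair X D f g) :
    LipPair X D (fun p => Real.exp (f p)) (fun p => Real.exp (g p)) := by
  obtain ⟨N, hN0, hN⟩ := h
  have key : ∀ u v : ℝ, u ≤ N → Real.exp u - Real.exp v ≤ Real.exp N * |u - v| := by
    intro u v hu
    have h1 : Real.exp v = Real.exp u * Real.exp (v - u) := by rw [← Real.exp_add]; ring_nf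
    have h2 := Real.add_one_le_exp (v - u)
    calc Real.exp u - Real.exp v = Real.exp u * (1 - Real.exp (v - u)) := by rw [h1]; ring
      _ ≤ Real.exp u * |u - v| := by
        gcongr
        linarith [le_abs_self (u - v)]
      _ ≤ Real.exp N * |u - v| := by gcongr
  refine ⟨Real.exp N * (N + 1), by positivity, fun p hp => ?_⟩
  obtain ⟨h1, h2, h3⟩ := hN p hp
  have hDp := hD p hp
  have hE := Real.exp_pos N
  have hEN : Real.exp N ≤ Real.exp N * (N + 1) := le_mul_of_one_le_right hE.le (by linarith)
  refine ⟨?_, ?_, ?_⟩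
  · rw [abs_of_pos (Real.exp_pos _)]
    exact (Real.exp_le_exp.2 (le_of_abs_le h1)).trans hEN
  · rw [abs_of_pos (Real.exp_pos _)]
    exact (Real.exp_le_exp.2 (le_of_abs_le h2)).trans hEN
  · have hb : Real.exp N * |f p - g p| ≤ Real.exp N * (N + 1) * D p := by
      rw [mul_assoc]
      gcongr
      nlinarith
    refine abs_sub_le_iff.2 ⟨(key _ _ (le_of_abs_le h1)).trans hb, ?_⟩
    have := key (g p) (f p) (le_of_abs_le h2)
    rw [abs_sub_comm] at this
    exact this.trans hb

end LipPair

/-- Continuous differentiability of `(t, x) ↦ f t x` on `[1, τ] × ℝ`. -/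
def C1On (τ : ℝ) (f : ℝ → ℝ → ℝ) : Prop :=
  ContDiffOn ℝ 1 (fun p : ℝ × ℝ => f p.1 p.2) (Icc 1 τ ×ˢ (univ : Set ℝ))

namespace C1On

variable {τ : ℝ} {f g : ℝ → ℝ → ℝ}

lemma add (hf : C1On τ f) (hg : C1On τ g) : C1On τ (fun t x => f t x + g t x) :=
  ContDiffOn.add hf hg

lemma sub (hf : C1On τ f) (hg : C1On τ g) : C1On τ (fun t x => f t x - g t x) :=
  ContDiffOn.sub hf hg

lemma mul (hf : C1On τ f) (hg : C1On τ g) : C1On τ (fun t x => f t x * g t x) :=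
  ContDiffOn.mul hf hg

lemma exp (hf : C1On τ f) : C1On τ (fun t x => Real.exp (f t x)) :=
  ContDiffOn.exp hf

lemma regAbs {ε : ℝ} (hε : 0 < ε) (hf : C1On τ f) : C1On τ (fun t x => regAbs ε (f t x)) :=
  (contDiff_regAbs hε).comp_contDiffOn hf

lemma contDiffAt (hf : C1On τ f) {t : ℝ} (ht : t ∈ Ioo 1 τ) (x : ℝ) :
    ContDiffAt ℝ 1 (fun p : ℝ × ℝ => f p.1 p.2) (t, x) :=
  ContDiffOn.contDiffAt hf (prod_mem_nhds (Icc_mem_nhds ht.1 ht.2) Filter.univ_mem)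

lemma hasFDerivAt (hf : C1On τ f) {t : ℝ} (ht : t ∈ Ioo 1 τ) (x : ℝ) :
    HasFDerivAt (fun p : ℝ × ℝ => f p.1 p.2)
      (fderiv ℝ (fun p : ℝ × ℝ => f p.1 p.2) (t, x)) (t, x) :=
  ((hf.contDiffAt ht x).differentiableAt one_ne_zero).hasFDerivAt

lemma hasDerivAt_fderiv_time (hf : C1On τ f) {t : ℝ} (ht : t ∈ Ioo 1 τ) (x : ℝ) :
    HasDerivAt (fun σ => f σ x) (fderiv ℝ (fun p : ℝ × ℝ => f p.1 p.2) (t, x) (1, 0)) t :=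
  HasFDerivAt.comp_hasDerivAt (f := fun σ : ℝ => (σ, x)) t (hf.hasFDerivAt ht x)
    ((hasDerivAt_id t).prodMk (hasDerivAt_const t x))

lemma hasDerivAt_fderiv_space (hf : C1On τ f) {t : ℝ} (ht : t ∈ Ioo 1 τ) (x : ℝ) :
    HasDerivAt (f t) (fderiv ℝ (fun p : ℝ × ℝ => f p.1 p.2) (t, x) (0, 1)) x :=
  HasFDerivAt.comp_hasDerivAt (f := fun y : ℝ => (t, y)) x (hf.hasFDerivAt ht x)
    ((hasDerivAt_const x t).prodMk (hasDerivAt_id x))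

lemma hasDerivAt_time (hf : C1On τ f) {t : ℝ} (ht : t ∈ Ioo 1 τ) (x : ℝ) :
    HasDerivAt (fun σ => f σ x) (pderivT f t x) t :=
  (hf.hasDerivAt_fderiv_time ht x).differentiableAt.hasDerivAt

lemma hasDerivAt_space (hf : C1On τ f) {t : ℝ} (ht : t ∈ Ioo 1 τ) (x : ℝ) :
    HasDerivAt (f t) (pderivX f t x) x :=
  (hf.hasDerivAt_fderiv_space ht x).differentiableAt.hasDerivAt

lemma continuous_fderiv (hf : C1On τ f) {t : ℝ} (ht : t ∈ Ioo 1 τ) :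
    Continuous fun x => fderiv ℝ (fun p : ℝ × ℝ => f p.1 p.2) (t, x) := by
  refine continuous_iff_continuousAt.2 fun x => ?_
  exact ContinuousAt.comp (f := fun x : ℝ => (t, x))
    ((hf.contDiffAt ht x).continuousAt_fderiv one_ne_zero) (by fun_prop)

lemma continuous_pderivT (hf : C1On τ f) {t : ℝ} (ht : t ∈ Ioo 1 τ) :
    Continuous fun x => pderivT f t x := by
  have : (fun x => pderivT f t x) =
      fun x => fderiv ℝ (fun p : ℝ × ℝ => f p.1 p.2) (t, x) (1, 0) :=
    funext fun x => (hf.hasDerivAt_fderiv_time ht x).deriv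
  rw [this]
  exact (hf.continuous_fderiv ht).clm_apply continuous_const

lemma continuous_pderivX (hf : C1On τ f) {t : ℝ} (ht : t ∈ Ioo 1 τ) :
    Continuous fun x => pderivX f t x := by
  have : (fun x => pderivX f t x) =
      fun x => fderiv ℝ (fun p : ℝ × ℝ => f p.1 p.2) (t, x) (0, 1) :=
    funext fun x => (hf.hasDerivAt_fderiv_space ht x).deriv
  rw [this]
  exact (hf.continuous_fderiv ht).clm_apply continuous_const

lemma continuous_slice (hf : C1On τ f) {t : ℝ} (ht : t ∈ Icc 1 τ) : Continuous (f t) :=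
  (ContDiffOn.continuousOn hf).comp_continuous (f := fun x : ℝ => (t, x)) (by fun_prop)
    fun x => ⟨ht, mem_univ x⟩

lemma exists_bound (hf : C1On τ f) (a b : ℝ) :
    ∃ N, ∀ p ∈ Ioo 1 τ ×ˢ Icc a b, |f p.1 p.2| ≤ N := by
  have hc : ContinuousOn (fun p : ℝ × ℝ => f p.1 p.2) (Icc 1 τ ×ˢ Icc a b) :=
    (ContDiffOn.continuousOn hf).mono (prod_mono_right (subset_univ _))
  obtain ⟨N, hN⟩ := (isCompact_Icc.prod isCompact_Icc).exists_bound_of_continuousOn hc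
  exact ⟨N, fun p hp => hN p ⟨Ioo_subset_Icc_self hp.1, hp.2⟩⟩

lemma exists_lipschitzOnWith (hf : C1On τ f) (a b : ℝ) :
    ∃ K, LipschitzOnWith K (fun p : ℝ × ℝ => f p.1 p.2) (Icc 1 τ ×ˢ Icc a b) :=
  (ContDiffOn.mono hf (prod_mono_right (subset_univ _))).exists_lipschitzOnWith one_ne_zero
    ((convex_Icc _ _).prod (convex_Icc _ _)) (isCompact_Icc.prod isCompact_Icc)

lemma exists_bound_pderivX (hf : C1On τ f) (a b : ℝ) :
    ∃ N, ∀ p ∈ Ioo 1 τ ×ˢ Icc a b, |pderivX f p.1 p.2| ≤ N := by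
  obtain ⟨K, hK⟩ := hf.exists_lipschitzOnWith (a - 1) (b + 1)
  refine ⟨K, fun p hp => ?_⟩
  have hs : Icc (a - 1) (b + 1) ∈ nhds p.2 :=
    Icc_mem_nhds (by linarith [hp.2.1]) (by linarith [hp.2.2])
  refine norm_deriv_le_of_lipschitzOn (f := fun x => f p.1 x) hs ?_
  have hg : LipschitzOnWith 1 (fun x : ℝ => (p.1, x)) (Icc (a - 1) (b + 1)) :=
    (LipschitzWith.prodMk_left p.1).lipschitzOnWith
  have hm : MapsTo (fun x : ℝ => (p.1, x)) (Icc (a - 1) (b + 1))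
      (Icc 1 τ ×ˢ Icc (a - 1) (b + 1)) :=
    fun x hx => ⟨Ioo_subset_Icc_self hp.1, hx⟩
  simpa [Function.comp_def] using hK.comp hg hm

lemma hasDerivAt_integral (hf : C1On τ f) (a b : ℝ) {t : ℝ} (ht : t ∈ Ioo 1 τ) :
    HasDerivAt (fun σ => ∫ x in a..b, f σ x) (∫ x in a..b, pderivT f t x) t := by
  obtain ⟨K, hK⟩ := hf.exists_lipschitzOnWith (min a b) (max a b)
  refine (intervalIntegral.hasDerivAt_integral_of_dominated_loc_of_lip (bound := fun _ => (K : ℝ))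
    (Icc_mem_nhds ht.1 ht.2) ?_ ?_ ?_ ?_ ?_ ?_).2
  · filter_upwards [Icc_mem_nhds ht.1 ht.2] with σ hσ
    exact (hf.continuous_slice hσ).aestronglyMeasurable
  · exact (hf.continuous_slice (Ioo_subset_Icc_self ht)).intervalIntegrable _ _
  · exact (hf.continuous_pderivT ht).aestronglyMeasurable
  · refine Filter.Eventually.of_forall fun x hx => ?_
    have hg : LipschitzOnWith 1 (fun σ : ℝ => (σ, x)) (Icc 1 τ) :=
      (LipschitzWith.prodMk_right x).lipschitzOnWith
    have hm : MapsTo (fun σ : ℝ => (σ, x)) (Icc 1 τ) (Icc 1 τ ×ˢ Icc (min a b) (max a b)) :=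
      fun σ hσ => ⟨hσ, uIoc_subset_uIcc hx⟩
    simpa [Function.comp_def] using hK.comp hg hm
  · exact intervalIntegrable_const
  · exact Filter.Eventually.of_forall fun x _ => hf.hasDerivAt_time ht x

lemma continuousOn_integral (hf : C1On τ f) (a b : ℝ) :
    ContinuousOn (fun σ => ∫ x in a..b, f σ x) (Icc 1 τ) := by
  rw [continuousOn_iff_continuous_domRestrict]
  refine intervalIntegral.continuous_parametric_intervalIntegral_of_continuous'
    (f := fun (σ : Icc 1 τ) x => f σ x) ?_ a b
  exact (ContDiffOn.continuousOn hf).comp_continuous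
    (f := fun q : Icc 1 τ × ℝ => ((q.1 : ℝ), q.2)) (by fun_prop) fun q => ⟨q.1.2, mem_univ _⟩

end C1On

/-- Grönwall estimate for a balance law `∂ₜΦ + ∂ₓH ≤ KΦ + C` whose flux has equal values at the
two ends of the space interval. -/
lemma integral_le_of_balance_law {τ a b K C : ℝ} {Φ H : ℝ → ℝ → ℝ} (hτ : 1 ≤ τ) (hab : a ≤ b)
    (hK : 0 ≤ K) (hC : 0 ≤ C) (hΦ : C1On τ Φ) (hH : C1On τ H)
    (hHab : ∀ t ∈ Ioo 1 τ, H t a = H t b)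
    (hineq : ∀ t ∈ Ioo 1 τ, ∀ x ∈ Icc a b, pderivT Φ t x + pderivX H t x ≤ K * Φ t x + C) :
    ∫ x in a..b, Φ τ x ≤
      Real.exp (K * (τ - 1)) * ((∫ x in a..b, Φ 1 x) + C * (b - a) * (τ - 1)) := by
  set E : ℝ → ℝ := fun t => ∫ x in a..b, Φ t x
  have hE' : ∀ t ∈ Ioo 1 τ, ∫ x in a..b, pderivT Φ t x ≤ K * E t + C * (b - a) := by
    intro t ht
    have iT := (hΦ.continuous_pderivT ht).intervalIntegrable (μ := volume) a b
    have iX := (hH.continuous_pderivX ht).intervalIntegrable (μ := volume) a b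
    have iΦ := (hΦ.continuous_slice (Ioo_subset_Icc_self ht)).intervalIntegrable (μ := volume) a b
    have h0 : ∫ x in a..b, pderivX H t x = 0 := by
      rw [intervalIntegral.integral_eq_sub_of_hasDerivAt
        (fun x _ => hH.hasDerivAt_space ht x) iX, hHab t ht, sub_self]
    calc ∫ x in a..b, pderivT Φ t x
        = ∫ x in a..b, (pderivT Φ t x + pderivX H t x) := by
          rw [intervalIntegral.integral_add iT iX, h0, add_zero]
      _ ≤ ∫ x in a..b, (K * Φ t x + C) :=
          intervalIntegral.integral_mono_on hab (iT.add iX)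
            ((iΦ.const_mul K).add intervalIntegrable_const) (hineq t ht)
      _ = K * E t + C * (b - a) := by
          rw [intervalIntegral.integral_add (iΦ.const_mul K) intervalIntegrable_const,
            intervalIntegral.integral_const_mul, intervalIntegral.integral_const, smul_eq_mul,
            mul_comm (b - a)]
  set G : ℝ → ℝ := fun t => Real.exp (-(K * (t - 1))) * E t - C * (b - a) * (t - 1) with hG
  have hGderiv : ∀ t ∈ Ioo 1 τ, HasDerivAt G
      (Real.exp (-(K * (t - 1))) * -K * E t +
        Real.exp (-(K * (t - 1))) * (∫ x in a..b, pderivT Φ t x) - C * (b - a)) t := by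
    intro t ht
    have h1 : HasDerivAt (fun t : ℝ => -(K * (t - 1))) (-K) t := by
      simpa using ((hasDerivAt_id t).sub_const 1).const_mul K |>.fun_neg
    have h2 : HasDerivAt (fun t : ℝ => C * (b - a) * (t - 1)) (C * (b - a)) t := by
      simpa using ((hasDerivAt_id t).sub_const 1).const_mul (C * (b - a))
    exact (h1.exp.mul (hΦ.hasDerivAt_integral a b ht)).sub h2
  have hanti : AntitoneOn G (Icc 1 τ) := by
    refine antitoneOn_of_deriv_nonpos (convex_Icc 1 τ) ?_ ?_ ?_
    · exact (ContinuousOn.mul (by fun_prop) (hΦ.continuousOn_integral a b)).sub (by fun_prop)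
    · rw [interior_Icc]
      exact fun t ht => (hGderiv t ht).differentiableAt.differentiableWithinAt
    · rw [interior_Icc]
      intro t ht
      rw [(hGderiv t ht).deriv]
      have h1 : Real.exp (-(K * (t - 1))) ≤ 1 :=
        Real.exp_le_one_iff.2 (neg_nonpos.2 (mul_nonneg hK (by linarith [ht.1])))
      have h2 := mul_le_mul_of_nonneg_left (hE' t ht) (Real.exp_pos (-(K * (t - 1)))).le
      have h3 : 0 ≤ C * (b - a) := mul_nonneg hC (by linarith)
      nlinarith
  have h := hanti ⟨le_rfl, hτ⟩ ⟨hτ, le_rfl⟩ hτ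
  simp only [hG, sub_self, mul_zero, neg_zero, Real.exp_zero, one_mul, sub_zero] at h
  have h' : Real.exp (-(K * (τ - 1))) * E τ ≤ E 1 + C * (b - a) * (τ - 1) := by linarith
  calc E τ = Real.exp (K * (τ - 1)) * (Real.exp (-(K * (τ - 1))) * E τ) := by
        rw [← mul_assoc, ← Real.exp_add, add_neg_cancel, Real.exp_zero, one_mul]
    _ ≤ _ := by gcongr

namespace RegularSolution

variable {Λ : ℝ} {J : Set ℝ} (sol : RegularSolution Λ J)

lemma pderivT_η_eq {t : ℝ} (ht : t ∈ J) (ht₀ : 0 < t) (x : ℝ) :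
    pderivT sol.η t x = 2 * π * t * Real.exp (2 * sol.η t x) * (sol.r t x + sol.s t x)
      - Λ / 2 * t * Real.exp (2 * sol.η t x) + 1 / 2 * t⁻¹ := by
  have h := sol.eqE2 t ht x
  rw [show -2 * sol.η t x = -(2 * sol.η t x) by ring, Real.exp_neg] at h
  have hw := (Real.exp_pos (2 * sol.η t x)).ne'
  field_simp at h ⊢
  linear_combination h

lemma pderivT_lam_eq {t : ℝ} (ht : t ∈ J) (ht₀ : 0 < t) (x : ℝ) :
    pderivT sol.lam t x = 2 * π * t * Real.exp (2 * sol.η t x) * (sol.r t x + sol.s t x)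
      + Λ / 2 * t * Real.exp (2 * sol.η t x) - 1 / 2 * t⁻¹ := by
  have h := sol.eqE1 t ht x
  rw [show -2 * sol.η t x = -(2 * sol.η t x) by ring, Real.exp_neg] at h
  have hw := (Real.exp_pos (2 * sol.η t x)).ne'
  field_simp at h ⊢
  linear_combination h

lemma exp_mul_pderivX_η_eq {t : ℝ} (ht : t ∈ J) (x : ℝ) :
    Real.exp (sol.η t x - sol.lam t x) * pderivX sol.η t x =
      -(2 * π * t * Real.exp (2 * sol.η t x) * (sol.r t x - sol.s t x)) := by
  have h : Real.exp (2 * sol.η t x) =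
      Real.exp (sol.η t x - sol.lam t x) * Real.exp (sol.lam t x + sol.η t x) := by
    rw [← Real.exp_add]; ring_nf
  rw [sol.eqE3 t ht x, h]
  ring

lemma transport_r {t : ℝ} (ht : t ∈ J) (ht₀ : 0 < t) (x : ℝ) :
    pderivT sol.r t x + Real.exp (sol.η t x - sol.lam t x) * pderivX sol.r t x =
      -((8 * π * t * Real.exp (2 * sol.η t x) * sol.s t x
        + Λ * t * Real.exp (2 * sol.η t x) + t⁻¹) * sol.r t x)
      - 2 / t * (√(sol.r t x) * √(sol.s t x)) := by
  rw [sol.eqE4 t ht x, sol.exp_mul_pderivX_η_eq ht, sol.pderivT_lam_eq ht ht₀,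
    Real.sqrt_mul (sol.r_nonneg t ht x)]
  ring

lemma transport_s {t : ℝ} (ht : t ∈ J) (ht₀ : 0 < t) (x : ℝ) :
    pderivT sol.s t x - Real.exp (sol.η t x - sol.lam t x) * pderivX sol.s t x =
      -((8 * π * t * Real.exp (2 * sol.η t x) * sol.r t x
        + Λ * t * Real.exp (2 * sol.η t x) + t⁻¹) * sol.s t x)
      - 2 / t * (√(sol.r t x) * √(sol.s t x)) := by
  rw [sol.eqE5 t ht x, sol.exp_mul_pderivX_η_eq ht, sol.pderivT_lam_eq ht ht₀,
    Real.sqrt_mul (sol.r_nonneg t ht x)]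
  ring

end RegularSolution

/-- Pointwise form of the regularized `L¹` estimate, for the differences `a, b, d, e` of the
unknowns `r, s, η, λ`. -/
lemma regularized_balance_le {ε t R Δ c cx N₁ N₂ N₃ N₄ N₅ a b d e at' bt dt et ax bx A B : ℝ}
    (hε : 0 < ε) (ht : 1 ≤ t) (hR : 0 ≤ R)
    (hN₁ : 0 ≤ N₁) (hN₂ : 0 ≤ N₂) (hN₃ : 0 ≤ N₃) (hN₄ : 0 ≤ N₄)
    (ha : at' + c * ax = A - 2 / t * Δ) (hb : bt - c * bx = B - 2 / t * Δ)
    (hA : |A| ≤ N₁ * (|a| + |b| + |d| + |e|)) (hB : |B| ≤ N₂ * (|a| + |b| + |d| + |e|))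
    (hd : |dt| ≤ N₃ * (|a| + |b| + |d| + |e|)) (he : |et| ≤ N₄ * (|a| + |b| + |d| + |e|))
    (hcx : |cx| ≤ N₅) (hΔ : -(a / regAbs ε a + b / regAbs ε b) * Δ ≤ R) :
    a / regAbs ε a * at' + b / regAbs ε b * bt + d / regAbs ε d * dt + e / regAbs ε e * et
      + (cx * (regAbs ε a - regAbs ε b)
        + c * (a / regAbs ε a * ax - b / regAbs ε b * bx))
      ≤ (N₁ + N₂ + N₃ + N₄ + N₅) * (regAbs ε a + regAbs ε b + regAbs ε d + regAbs ε e)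
        + 2 * R := by
  have sgn : ∀ y z : ℝ, y / regAbs ε y * z ≤ |z| := fun y z =>
    calc y / regAbs ε y * z ≤ |y / regAbs ε y| * |z| := by
          rw [← abs_mul]; exact le_abs_self _
      _ ≤ 1 * |z| := by gcongr; exact abs_div_regAbs_le_one hε y
      _ = |z| := one_mul _
  set S := regAbs ε a + regAbs ε b + regAbs ε d + regAbs ε e with hS
  have hDS : |a| + |b| + |d| + |e| ≤ S := by
    linarith [abs_le_regAbs ε a, abs_le_regAbs ε b, abs_le_regAbs ε d, abs_le_regAbs ε e]
  have h1 := (sgn a A).trans (hA.trans (mul_le_mul_of_nonneg_left hDS hN₁))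
  have h2 := (sgn b B).trans (hB.trans (mul_le_mul_of_nonneg_left hDS hN₂))
  have h3 := (sgn d dt).trans (hd.trans (mul_le_mul_of_nonneg_left hDS hN₃))
  have h4 := (sgn e et).trans (he.trans (mul_le_mul_of_nonneg_left hDS hN₄))
  have pa := regAbs_pos hε a
  have pb := regAbs_pos hε b
  have pd := regAbs_pos hε d
  have pe := regAbs_pos hε e
  have h5 : cx * (regAbs ε a - regAbs ε b) ≤ N₅ * S :=
    calc cx * (regAbs ε a - regAbs ε b) ≤ |cx| * |regAbs ε a - regAbs ε b| := by
          rw [← abs_mul]; exact le_abs_self _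
      _ ≤ N₅ * S := by
          refine mul_le_mul hcx ?_ (abs_nonneg _) ((abs_nonneg _).trans hcx)
          exact abs_le.2 ⟨by linarith, by linarith⟩
  have h6 : 2 / t * (-(a / regAbs ε a + b / regAbs ε b) * Δ) ≤ 2 * R :=
    calc _ ≤ 2 / t * R := by gcongr
      _ ≤ 2 * R := by gcongr; exact div_le_self zero_le_two ht
  have ea : at' = A - 2 / t * Δ - c * ax := by linarith
  have eb : bt = B - 2 / t * Δ + c * bx := by linarith
  rw [ea, eb]
  nlinarith

lemma Icc_subset_timeSlab {T : EReal} {τ : ℝ} (hτ : τ ∈ timeSlab T) : Icc 1 τ ⊆ timeSlab T :=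
  fun _ ht => ⟨ht.1, (EReal.coe_le_coe_iff.2 ht.2).trans_lt hτ.2⟩

section Difference

variable {Λ : ℝ} {T : EReal} (sol₁ sol₂ : RegularSolution Λ (timeSlab T))

/-- The pointwise `L¹` distance between two solutions. -/
def solDist (t x : ℝ) : ℝ :=
  |sol₁.r t x - sol₂.r t x| + |sol₁.s t x - sol₂.s t x| +
    |sol₁.η t x - sol₂.η t x| + |sol₁.lam t x - sol₂.lam t x|

/-- The regularized pointwise `L¹` distance between two solutions. -/
def regDist (ε t x : ℝ) : ℝ :=
  regAbs ε (sol₁.r t x - sol₂.r t x) + regAbs ε (sol₁.s t x - sol₂.s t x) +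
    regAbs ε (sol₁.η t x - sol₂.η t x) + regAbs ε (sol₁.lam t x - sol₂.lam t x)

/-- The flux of the balance law satisfied by `regDist`. -/
def regFlux (ε t x : ℝ) : ℝ :=
  Real.exp (sol₁.η t x - sol₁.lam t x) *
    (regAbs ε (sol₁.r t x - sol₂.r t x) - regAbs ε (sol₁.s t x - sol₂.s t x))

lemma solDist_nonneg (t x : ℝ) : 0 ≤ solDist sol₁ sol₂ t x := by
  unfold solDist; positivity

lemma solDist_le_regDist (ε t x : ℝ) : solDist sol₁ sol₂ t x ≤ regDist sol₁ sol₂ ε t x := by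
  unfold solDist regDist
  gcongr <;> exact abs_le_regAbs _ _

/-- Along two solutions, the right-hand sides of the evolution equations, without the square-root
coupling and with the difference of the characteristic speeds absorbed, are Lipschitz. -/
lemma exists_rate_bounds {τ : ℝ} (hτ : τ ∈ timeSlab T) (a b : ℝ) :
    ∃ N, 0 ≤ N ∧ ∀ t ∈ Ioo 1 τ, ∀ x ∈ Icc a b,
      (sol₁.r t x ≤ N ∧ sol₂.r t x ≤ N ∧ sol₁.s t x ≤ N ∧ sol₂.s t x ≤ N) ∧
      |pderivX (fun t x => Real.exp (sol₁.η t x - sol₁.lam t x)) t x| ≤ N ∧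
      (∃ A, |A| ≤ N * solDist sol₁ sol₂ t x ∧
        (pderivT sol₁.r t x - pderivT sol₂.r t x) + Real.exp (sol₁.η t x - sol₁.lam t x) *
            (pderivX sol₁.r t x - pderivX sol₂.r t x) =
          A - 2 / t * (√(sol₁.r t x) * √(sol₁.s t x) - √(sol₂.r t x) * √(sol₂.s t x))) ∧
      (∃ A, |A| ≤ N * solDist sol₁ sol₂ t x ∧
        (pderivT sol₁.s t x - pderivT sol₂.s t x) - Real.exp (sol₁.η t x - sol₁.lam t x) *
            (pderivX sol₁.s t x - pderivX sol₂.s t x) =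
          A - 2 / t * (√(sol₁.r t x) * √(sol₁.s t x) - √(sol₂.r t x) * √(sol₂.s t x))) ∧
      |pderivT sol₁.η t x - pderivT sol₂.η t x| ≤ N * solDist sol₁ sol₂ t x ∧
      |pderivT sol₁.lam t x - pderivT sol₂.lam t x| ≤ N * solDist sol₁ sol₂ t x := by
  have hsub := Icc_subset_timeSlab hτ
  have hmono : Icc 1 τ ×ˢ (univ : Set ℝ) ⊆ timeSlab T ×ˢ univ := prod_mono_left hsub
  set X : Set (ℝ × ℝ) := Ioo 1 τ ×ˢ Icc a b
  set D : ℝ × ℝ → ℝ := fun p => solDist sol₁ sol₂ p.1 p.2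
  have hD : ∀ p ∈ X, 0 ≤ D p := fun p _ => solDist_nonneg _ _ _ _
  have base : ∀ {f g : ℝ → ℝ → ℝ}, C1On τ f → C1On τ g →
      (∀ t x, |f t x - g t x| ≤ solDist sol₁ sol₂ t x) →
      LipPair X D (fun p => f p.1 p.2) (fun p => g p.1 p.2) := by
    intro f g hf hg hfg
    obtain ⟨N, hN⟩ := hf.exists_bound a b
    obtain ⟨M, hM⟩ := hg.exists_bound a b
    refine ⟨max 1 (max N M), zero_le_one.trans (le_max_left _ _), fun p hp => ⟨?_, ?_, ?_⟩⟩
    · exact (hN p hp).trans ((le_max_left _ _).trans (le_max_right _ _))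
    · exact (hM p hp).trans ((le_max_right _ _).trans (le_max_right _ _))
    · exact (hfg _ _).trans (le_mul_of_one_le_left (hD p hp) (le_max_left _ _))
  have hr : LipPair X D (fun p => sol₁.r p.1 p.2) (fun p => sol₂.r p.1 p.2) :=
    base (sol₁.r_c1.mono hmono) (sol₂.r_c1.mono hmono) fun t x => by
      unfold solDist
      linarith [abs_nonneg (sol₁.s t x - sol₂.s t x), abs_nonneg (sol₁.η t x - sol₂.η t x),
        abs_nonneg (sol₁.lam t x - sol₂.lam t x)]
  have hs : LipPair X D (fun p => sol₁.s p.1 p.2) (fun p => sol₂.s p.1 p.2) :=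
    base (sol₁.s_c1.mono hmono) (sol₂.s_c1.mono hmono) fun t x => by
      unfold solDist
      linarith [abs_nonneg (sol₁.r t x - sol₂.r t x), abs_nonneg (sol₁.η t x - sol₂.η t x),
        abs_nonneg (sol₁.lam t x - sol₂.lam t x)]
  have hη : LipPair X D (fun p => sol₁.η p.1 p.2) (fun p => sol₂.η p.1 p.2) :=
    base (sol₁.η_c1.mono hmono) (sol₂.η_c1.mono hmono) fun t x => by
      unfold solDist
      linarith [abs_nonneg (sol₁.r t x - sol₂.r t x), abs_nonneg (sol₁.s t x - sol₂.s t x),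
        abs_nonneg (sol₁.lam t x - sol₂.lam t x)]
  have hl : LipPair X D (fun p => sol₁.lam p.1 p.2) (fun p => sol₂.lam p.1 p.2) :=
    base (sol₁.lam_c1.mono hmono) (sol₂.lam_c1.mono hmono) fun t x => by
      unfold solDist
      linarith [abs_nonneg (sol₁.r t x - sol₂.r t x), abs_nonneg (sol₁.s t x - sol₂.s t x),
        abs_nonneg (sol₁.η t x - sol₂.η t x)]
  have ht : LipPair X D (fun p => p.1) (fun p => p.1) :=
    LipPair.of_bound hD ⟨τ, fun p hp => by
      rw [abs_of_pos (zero_lt_one.trans hp.1.1)]; exact hp.1.2.le⟩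
  have hti : LipPair X D (fun p => p.1⁻¹) (fun p => p.1⁻¹) :=
    LipPair.of_bound hD ⟨1, fun p hp => by
      rw [abs_of_pos (inv_pos.2 (zero_lt_one.trans hp.1.1))]
      exact inv_le_one_of_one_le₀ hp.1.1.le⟩
  have hw := ((LipPair.const hD 2).mul hD hη).exp hD
  have hc := (hη.sub hl).exp hD
  have hrx := LipPair.of_bound hD
    (C1On.exists_bound_pderivX (f := sol₂.r) (sol₂.r_c1.mono hmono) a b)
  have hsx := LipPair.of_bound hD
    (C1On.exists_bound_pderivX (f := sol₂.s) (sol₂.s_c1.mono hmono) a b)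
  obtain ⟨N₀, hN₀⟩ := C1On.exists_bound_pderivX
    (f := fun t x => Real.exp (sol₁.η t x - sol₁.lam t x))
    (C1On.exp (C1On.sub (sol₁.η_c1.mono hmono) (sol₁.lam_c1.mono hmono))) a b
  have k := fun c => LipPair.const (D := D) hD c
  have hΛ := ((k Λ).mul hD ht).mul hD hw
  have hQr := ((((((((k (8 * π)).mul hD ht).mul hD hw).mul hD hs).add hΛ).add hti).mul
    hD hr).neg).sub (hc.mul hD hrx)
  have hQs := ((((((((k (8 * π)).mul hD ht).mul hD hw).mul hD hr).add hΛ).add hti).mul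
    hD hs).neg).add (hc.mul hD hsx)
  have hsum := (((k (2 * π)).mul hD ht).mul hD hw).mul hD (hr.add hs)
  have hΛ' := ((k (Λ / 2)).mul hD ht).mul hD hw
  have hti' := (k (1 / 2)).mul hD hti
  obtain ⟨N₁, hN₁, h₁⟩ := hr
  obtain ⟨N₂, hN₂, h₂⟩ := hs
  obtain ⟨N₃, hN₃, h₃⟩ := hQr
  obtain ⟨N₄, hN₄, h₄⟩ := hQs
  obtain ⟨N₅, hN₅, h₅⟩ := (hsum.sub hΛ').add hti'
  obtain ⟨N₆, hN₆, h₆⟩ := (hsum.add hΛ').sub hti'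
  have hN₀' := abs_nonneg N₀
  refine ⟨|N₀| + N₁ + N₂ + N₃ + N₄ + N₅ + N₆, by positivity, fun t htt x hx => ?_⟩
  have hp : ((t, x) : ℝ × ℝ) ∈ X := ⟨htt, hx⟩
  have htJ : t ∈ timeSlab T := hsub (Ioo_subset_Icc_self htt)
  have ht0 : 0 < t := zero_lt_one.trans htt.1
  have hD0 : 0 ≤ solDist sol₁ sol₂ t x := solDist_nonneg _ _ _ _
  obtain ⟨r1, r2, -⟩ := h₁ _ hp
  obtain ⟨s1, s2, -⟩ := h₂ _ hp
  obtain ⟨-, -, q3⟩ := h₃ _ hp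
  obtain ⟨-, -, q4⟩ := h₄ _ hp
  obtain ⟨-, -, q5⟩ := h₅ _ hp
  obtain ⟨-, -, q6⟩ := h₆ _ hp
  refine ⟨⟨?_, ?_, ?_, ?_⟩, ?_, ⟨_, q3.trans ?_, ?_⟩, ⟨_, q4.trans ?_, ?_⟩, ?_, ?_⟩
  · linarith [le_of_abs_le r1]
  · linarith [le_of_abs_le r2]
  · linarith [le_of_abs_le s1]
  · linarith [le_of_abs_le s2]
  · have q0 := hN₀ _ hp
    linarith [le_abs_self N₀]
  · exact mul_le_mul_of_nonneg_right (by linarith) hD0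
  · linear_combination sol₁.transport_r htJ ht0 x - sol₂.transport_r htJ ht0 x
  · exact mul_le_mul_of_nonneg_right (by linarith) hD0
  · linear_combination sol₁.transport_s htJ ht0 x - sol₂.transport_s htJ ht0 x
  · rw [sol₁.pderivT_η_eq htJ ht0, sol₂.pderivT_η_eq htJ ht0]
    exact q5.trans (mul_le_mul_of_nonneg_right (by linarith) hD0)
  · rw [sol₁.pderivT_lam_eq htJ ht0, sol₂.pderivT_lam_eq htJ ht0]
    exact q6.trans (mul_le_mul_of_nonneg_right (by linarith) hD0)

lemma C1On.regDist {τ ε : ℝ} (hε : 0 < ε) (hτ : τ ∈ timeSlab T) :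
    C1On τ (regDist sol₁ sol₂ ε) := by
  have hmono : Icc 1 τ ×ˢ (univ : Set ℝ) ⊆ timeSlab T ×ˢ univ :=
    prod_mono_left (Icc_subset_timeSlab hτ)
  exact (((C1On.sub (sol₁.r_c1.mono hmono) (sol₂.r_c1.mono hmono)).regAbs hε).add
    ((C1On.sub (sol₁.s_c1.mono hmono) (sol₂.s_c1.mono hmono)).regAbs hε)).add
    ((C1On.sub (sol₁.η_c1.mono hmono) (sol₂.η_c1.mono hmono)).regAbs hε) |>.add
    ((C1On.sub (sol₁.lam_c1.mono hmono) (sol₂.lam_c1.mono hmono)).regAbs hε)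

lemma C1On.regFlux {τ ε : ℝ} (hε : 0 < ε) (hτ : τ ∈ timeSlab T) :
    C1On τ (regFlux sol₁ sol₂ ε) := by
  have hmono : Icc 1 τ ×ˢ (univ : Set ℝ) ⊆ timeSlab T ×ˢ univ :=
    prod_mono_left (Icc_subset_timeSlab hτ)
  exact (C1On.sub (sol₁.η_c1.mono hmono) (sol₁.lam_c1.mono hmono)).exp.mul
    (((C1On.sub (sol₁.r_c1.mono hmono) (sol₂.r_c1.mono hmono)).regAbs hε).sub
    ((C1On.sub (sol₁.s_c1.mono hmono) (sol₂.s_c1.mono hmono)).regAbs hε))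

/-- The balance law satisfied by the regularized distance, with constants uniform in `ε`. -/
lemma exists_regDist_balance {τ : ℝ} (hτ : τ ∈ timeSlab T) (a b : ℝ) :
    ∃ K C, 0 ≤ K ∧ 0 ≤ C ∧ ∀ ε, 0 < ε → ∀ t ∈ Ioo 1 τ, ∀ x ∈ Icc a b,
      pderivT (regDist sol₁ sol₂ ε) t x + pderivX (regFlux sol₁ sol₂ ε) t x ≤
        K * regDist sol₁ sol₂ ε t x + C * √ε := by
  obtain ⟨N, hN, h⟩ := exists_rate_bounds sol₁ sol₂ hτ a b
  have hmono : Icc 1 τ ×ˢ (univ : Set ℝ) ⊆ timeSlab T ×ˢ univ :=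
    prod_mono_left (Icc_subset_timeSlab hτ)
  refine ⟨N + N + N + N + N, 2 * √N, by positivity, by positivity, fun ε hε t ht x hx => ?_⟩
  obtain ⟨⟨r1, r2, s1, s2⟩, hcx, ⟨A, hA, hAeq⟩, ⟨B, hB, hBeq⟩, hd, he⟩ := h t ht x hx
  have htJ : t ∈ timeSlab T := Icc_subset_timeSlab hτ (Ioo_subset_Icc_self ht)
  have dr₁ : C1On τ sol₁.r := sol₁.r_c1.mono hmono
  have dr₂ : C1On τ sol₂.r := sol₂.r_c1.mono hmono
  have ds₁ : C1On τ sol₁.s := sol₁.s_c1.mono hmono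
  have ds₂ : C1On τ sol₂.s := sol₂.s_c1.mono hmono
  have dη₁ : C1On τ sol₁.η := sol₁.η_c1.mono hmono
  have dη₂ : C1On τ sol₂.η := sol₂.η_c1.mono hmono
  have dl₁ : C1On τ sol₁.lam := sol₁.lam_c1.mono hmono
  have dl₂ : C1On τ sol₂.lam := sol₂.lam_c1.mono hmono
  have reg : ∀ {f g : ℝ → ℝ} {f' g' y : ℝ}, HasDerivAt f f' y → HasDerivAt g g' y →
      HasDerivAt (fun z => regAbs ε (f z - g z))
        ((f y - g y) / regAbs ε (f y - g y) * (f' - g')) y :=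
    fun {f g _ _ y} hf hg => HasDerivAt.comp (h₂ := regAbs ε) (h := fun z => f z - g z) y
      (hasDerivAt_regAbs hε _) (hf.sub hg)
  have hT : pderivT (regDist sol₁ sol₂ ε) t x = _ :=
    ((((reg (dr₁.hasDerivAt_time ht x) (dr₂.hasDerivAt_time ht x)).add
      (reg (ds₁.hasDerivAt_time ht x) (ds₂.hasDerivAt_time ht x))).add
      (reg (dη₁.hasDerivAt_time ht x) (dη₂.hasDerivAt_time ht x))).add
      (reg (dl₁.hasDerivAt_time ht x) (dl₂.hasDerivAt_time ht x))).deriv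
  have hX : pderivX (regFlux sol₁ sol₂ ε) t x = _ :=
    (((dη₁.sub dl₁).exp.hasDerivAt_space ht x).mul
      ((reg (dr₁.hasDerivAt_space ht x) (dr₂.hasDerivAt_space ht x)).sub
        (reg (ds₁.hasDerivAt_space ht x) (ds₂.hasDerivAt_space ht x)))).deriv
  rw [hT, hX, mul_assoc]
  exact regularized_balance_le hε ht.1.le (by positivity) hN hN hN hN hAeq hBeq hA hB hd he hcx
    (neg_regSign_mul_sqrt_le hε (sol₁.r_nonneg t htJ x) (sol₂.r_nonneg t htJ x)
      (sol₁.s_nonneg t htJ x) (sol₂.s_nonneg t htJ x) r1 r2 s1 s2)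

lemma continuous_solDist {τ : ℝ} (hτ : τ ∈ timeSlab T) : Continuous (solDist sol₁ sol₂ τ) := by
  have slice : ∀ {f : ℝ → ℝ → ℝ},
      ContDiffOn ℝ 1 (fun p : ℝ × ℝ => f p.1 p.2) (timeSlab T ×ˢ univ) → Continuous (f τ) :=
    fun hf => C1On.continuous_slice (τ := τ)
      (hf.mono (prod_mono_left (Icc_subset_timeSlab hτ))) ⟨hτ.1, le_rfl⟩
  exact ((((slice sol₁.r_c1).sub (slice sol₂.r_c1)).abs.add
    ((slice sol₁.s_c1).sub (slice sol₂.s_c1)).abs).add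
    ((slice sol₁.η_c1).sub (slice sol₂.η_c1)).abs).add
    ((slice sol₁.lam_c1).sub (slice sol₂.lam_c1)).abs

lemma integral_solDist_nonpos {τ : ℝ} (hτ : τ ∈ timeSlab T)
    (h₀ : ∀ x, solDist sol₁ sol₂ 1 x = 0) (x₀ : ℝ) :
    ∫ x in x₀..(x₀ + 1), solDist sol₁ sol₂ τ x ≤ 0 := by
  obtain ⟨K, C, hK, hC, h⟩ := exists_regDist_balance sol₁ sol₂ hτ x₀ (x₀ + 1)
  have hbound : ∀ ε, 0 < ε → ∫ x in x₀..(x₀ + 1), solDist sol₁ sol₂ τ x ≤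
      Real.exp (K * (τ - 1)) * (4 * ε + C * √ε * (τ - 1)) := by
    intro ε hε
    have hcont := (C1On.regDist sol₁ sol₂ hε hτ).continuous_slice ⟨hτ.1, le_rfl⟩
    have hbal := integral_le_of_balance_law (b := x₀ + 1) hτ.1 (by linarith) hK
      (mul_nonneg hC (Real.sqrt_nonneg ε)) (C1On.regDist sol₁ sol₂ hε hτ)
      (C1On.regFlux sol₁ sol₂ hε hτ) ?_ (h ε hε)
    · have hinit : ∀ x, regDist sol₁ sol₂ ε 1 x = 4 * ε := by
        intro x
        have hx := h₀ x
        unfold solDist at hx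
        have n1 := abs_nonneg (sol₁.r 1 x - sol₂.r 1 x)
        have n2 := abs_nonneg (sol₁.s 1 x - sol₂.s 1 x)
        have n3 := abs_nonneg (sol₁.η 1 x - sol₂.η 1 x)
        have n4 := abs_nonneg (sol₁.lam 1 x - sol₂.lam 1 x)
        have z1 := abs_eq_zero.1 (show |sol₁.r 1 x - sol₂.r 1 x| = 0 by linarith)
        have z2 := abs_eq_zero.1 (show |sol₁.s 1 x - sol₂.s 1 x| = 0 by linarith)
        have z3 := abs_eq_zero.1 (show |sol₁.η 1 x - sol₂.η 1 x| = 0 by linarith)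
        have z4 := abs_eq_zero.1 (show |sol₁.lam 1 x - sol₂.lam 1 x| = 0 by linarith)
        rw [regDist, z1, z2, z3, z4, regAbs_zero hε]
        ring
      simp only [hinit, intervalIntegral.integral_const, add_sub_cancel_left, one_smul,
        mul_one] at hbal
      refine le_trans ?_ hbal
      refine intervalIntegral.integral_mono_on (by linarith) ?_ (hcont.intervalIntegrable _ _)
        fun x _ => solDist_le_regDist _ _ _ _ _
      exact (continuous_solDist sol₁ sol₂ hτ).intervalIntegrable _ _
    · intro t ht
      have htJ := Icc_subset_timeSlab hτ (Ioo_subset_Icc_self ht)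
      simp only [regFlux, sol₁.η_per t htJ, sol₁.lam_per t htJ, sol₁.r_per t htJ,
        sol₂.r_per t htJ, sol₁.s_per t htJ, sol₂.s_per t htJ]
  have hlim : Filter.Tendsto
      (fun ε : ℝ => Real.exp (K * (τ - 1)) * (4 * ε + C * √ε * (τ - 1)))
      (nhdsWithin 0 (Ioi 0)) (nhds 0) := by
    have hc : Continuous
        fun ε : ℝ => Real.exp (K * (τ - 1)) * (4 * ε + C * √ε * (τ - 1)) := by fun_prop
    simpa using (hc.tendsto 0).mono_left nhdsWithin_le_nhds
  exact ge_of_tendsto hlim (eventually_mem_nhdsWithin.mono hbound)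

end Difference

/-- Uniqueness of regular solutions. -/
theorem uniqueness_regular_solutions (Λ : ℝ) (hΛ : 0 < Λ) (T : EReal) (hT : 1 < T)
    (sol₁ sol₂ : RegularSolution Λ (timeSlab T))
    (hη : ∀ x : ℝ, sol₁.η 1 x = sol₂.η 1 x)
    (hlam : ∀ x : ℝ, sol₁.lam 1 x = sol₂.lam 1 x)
    (hr : ∀ x : ℝ, sol₁.r 1 x = sol₂.r 1 x)
    (hs : ∀ x : ℝ, sol₁.s 1 x = sol₂.s 1 x) :
    ∀ t ∈ timeSlab T, ∀ x : ℝ,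
      sol₁.η t x = sol₂.η t x ∧ sol₁.lam t x = sol₂.lam t x ∧
      sol₁.r t x = sol₂.r t x ∧ sol₁.s t x = sol₂.s t x := by
  intro t ht x
  have h₀ : ∀ x, solDist sol₁ sol₂ 1 x = 0 := fun x => by
    simp [solDist, hη x, hlam x, hr x, hs x]
  have hnonpos : solDist sol₁ sol₂ t x ≤ 0 := by
    by_contra! hpos
    refine (integral_solDist_nonpos sol₁ sol₂ ht h₀ x).not_gt ?_
    exact intervalIntegral.integral_pos (lt_add_one x)
      (continuous_solDist sol₁ sol₂ ht).continuousOn (fun _ _ => solDist_nonneg _ _ _ _)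
      ⟨x, left_mem_Icc.2 (lt_add_one x).le, hpos⟩
  unfold solDist at hnonpos
  have n1 := abs_nonneg (sol₁.r t x - sol₂.r t x)
  have n2 := abs_nonneg (sol₁.s t x - sol₂.s t x)
  have n3 := abs_nonneg (sol₁.η t x - sol₂.η t x)
  have n4 := abs_nonneg (sol₁.lam t x - sol₂.lam t x)
  refine ⟨?_, ?_, ?_, ?_⟩ <;> refine sub_eq_zero.1 (abs_eq_zero.1 ?_) <;> linarith
end
end

section
/- (Boundedness of η on finite intervals, Lemma 4.3.) Let (η, λ, r, s) be a regular solution on [1,T) with T < ∞. Then sup{ |η(t,x)| : t ∈ [1,T), x ∈ ℝ } < ∞. -/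
open Real Set MeasureTheory

noncomputable section

section PartialDerivatives

variable {F : ℝ → ℝ → ℝ} {U : Set (ℝ × ℝ)} {t x : ℝ}

theorem hasFDerivAt_of_contDiffOn_isOpen (hU : IsOpen U)
    (hF : ContDiffOn ℝ 1 (fun p : ℝ × ℝ => F p.1 p.2) U) (h : (t, x) ∈ U) :
    HasFDerivAt (fun p : ℝ × ℝ => F p.1 p.2)
      (fderiv ℝ (fun p : ℝ × ℝ => F p.1 p.2) (t, x)) (t, x) :=
  ((hF.contDiffAt (hU.mem_nhds h)).differentiableAt one_ne_zero).hasFDerivAt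

theorem hasDerivAt_fst_fderiv (hU : IsOpen U)
    (hF : ContDiffOn ℝ 1 (fun p : ℝ × ℝ => F p.1 p.2) U) (h : (t, x) ∈ U) :
    HasDerivAt (fun τ => F τ x) (fderiv ℝ (fun p : ℝ × ℝ => F p.1 p.2) (t, x) (1, 0)) t :=
  (hasFDerivAt_of_contDiffOn_isOpen hU hF h).comp_hasDerivAt (f := fun τ => (τ, x)) t
    ((hasDerivAt_id t).prodMk (hasDerivAt_const t x))

theorem hasDerivAt_snd_fderiv (hU : IsOpen U)
    (hF : ContDiffOn ℝ 1 (fun p : ℝ × ℝ => F p.1 p.2) U) (h : (t, x) ∈ U) :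
    HasDerivAt (fun y => F t y) (fderiv ℝ (fun p : ℝ × ℝ => F p.1 p.2) (t, x) (0, 1)) x :=
  (hasFDerivAt_of_contDiffOn_isOpen hU hF h).comp_hasDerivAt (f := fun y => (t, y)) x
    ((hasDerivAt_const x t).prodMk (hasDerivAt_id x))

theorem hasDerivAt_pderivT (hU : IsOpen U)
    (hF : ContDiffOn ℝ 1 (fun p : ℝ × ℝ => F p.1 p.2) U) (h : (t, x) ∈ U) :
    HasDerivAt (fun τ => F τ x) (pderivT F t x) t :=
  (hasDerivAt_fst_fderiv hU hF h).differentiableAt.hasDerivAt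

theorem hasDerivAt_pderivX (hU : IsOpen U)
    (hF : ContDiffOn ℝ 1 (fun p : ℝ × ℝ => F p.1 p.2) U) (h : (t, x) ∈ U) :
    HasDerivAt (fun y => F t y) (pderivX F t x) x :=
  (hasDerivAt_snd_fderiv hU hF h).differentiableAt.hasDerivAt

theorem continuousOn_pderivT (hU : IsOpen U)
    (hF : ContDiffOn ℝ 1 (fun p : ℝ × ℝ => F p.1 p.2) U) :
    ContinuousOn (fun p : ℝ × ℝ => pderivT F p.1 p.2) U :=
  ((hF.continuousOn_fderiv_of_isOpen hU le_rfl).clm_apply continuousOn_const).congr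
    fun _ hp => (hasDerivAt_fst_fderiv hU hF hp).deriv

theorem continuousOn_pderivX (hU : IsOpen U)
    (hF : ContDiffOn ℝ 1 (fun p : ℝ × ℝ => F p.1 p.2) U) :
    ContinuousOn (fun p : ℝ × ℝ => pderivX F p.1 p.2) U :=
  ((hF.continuousOn_fderiv_of_isOpen hU le_rfl).clm_apply continuousOn_const).congr
    fun _ hp => (hasDerivAt_snd_fderiv hU hF hp).deriv

end PartialDerivatives

theorem continuous_slice {F : ℝ → ℝ → ℝ} {J : Set ℝ}
    (hF : ContinuousOn (fun p : ℝ × ℝ => F p.1 p.2) (J ×ˢ (univ : Set ℝ))) {t : ℝ} (ht : t ∈ J) :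
    Continuous (F t) :=
  hF.comp_continuous (f := fun x : ℝ => (t, x)) (by fun_prop) fun _ => ⟨ht, mem_univ _⟩

/-- Differentiation under the integral sign over the unit interval. -/
theorem hasDerivAt_integral_pderivT {F : ℝ → ℝ → ℝ} {J : Set ℝ} (hJ : IsOpen J)
    (hF : ContDiffOn ℝ 1 (fun p : ℝ × ℝ => F p.1 p.2) (J ×ˢ (univ : Set ℝ))) {t : ℝ} (ht : t ∈ J) :
    HasDerivAt (fun τ => ∫ x in (0 : ℝ)..1, F τ x) (∫ x in (0 : ℝ)..1, pderivT F t x) t := by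
  have hU : IsOpen (J ×ˢ (univ : Set ℝ)) := hJ.prod isOpen_univ
  have hc := continuousOn_pderivT hU hF
  obtain ⟨ε, hε, hball⟩ := Metric.nhds_basis_closedBall.mem_iff.1 (hJ.mem_nhds ht)
  obtain ⟨C, hC⟩ := ((isCompact_closedBall t ε).prod (isCompact_Icc (a := (0 : ℝ)) (b := 1))
    ).exists_bound_of_continuousOn (hc.mono (prod_mono hball (subset_univ _)))
  refine (intervalIntegral.hasDerivAt_integral_of_dominated_loc_of_deriv_le
    (F := F) (F' := fun τ x => pderivT F τ x) (bound := fun _ => C)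
    (Metric.closedBall_mem_nhds t hε) ?_ ?_ ?_ ?_ ?_ ?_).2
  · filter_upwards [hJ.mem_nhds ht] with τ hτ
    exact (continuous_slice hF.continuousOn hτ).aestronglyMeasurable
  · exact (continuous_slice hF.continuousOn ht).intervalIntegrable _ _
  · exact (continuous_slice (F := pderivT F) hc ht).aestronglyMeasurable
  · refine Filter.Eventually.of_forall fun x hx τ hτ => hC (τ, x) ⟨hτ, ?_⟩
    rw [uIoc_of_le zero_le_one] at hx
    exact Ioc_subset_Icc_self hx
  · exact intervalIntegrable_const
  · exact Filter.Eventually.of_forall fun x _ τ hτ =>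
      hasDerivAt_pderivT hU hF ⟨hball hτ, mem_univ _⟩

theorem apply_fract_of_periodic {f : ℝ → ℝ} (hf : Function.Periodic f 1) (x : ℝ) :
    f (Int.fract x) = f x := by
  have h := hf.sub_int_mul_eq (x := x) ⌊x⌋
  rwa [mul_one] at h

theorem exists_abs_le_of_periodic {F : ℝ → ℝ → ℝ} {K : Set ℝ} (hK : IsCompact K)
    (hF : ContinuousOn (fun p : ℝ × ℝ => F p.1 p.2) (K ×ˢ (univ : Set ℝ)))
    (hper : ∀ t ∈ K, ∀ x, F t (x + 1) = F t x) :
    ∃ M, ∀ t ∈ K, ∀ x, |F t x| ≤ M := by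
  obtain ⟨M, hM⟩ := (hK.prod (isCompact_Icc (a := (0 : ℝ)) (b := 1))
    ).exists_bound_of_continuousOn (hF.mono (prod_mono_right (subset_univ _)))
  refine ⟨M, fun t ht x => ?_⟩
  rw [← apply_fract_of_periodic (hper t ht)]
  exact hM (t, Int.fract x) ⟨ht, Int.fract_nonneg x, (Int.fract_lt_one x).le⟩

theorem sub_le_mul_sub_of_hasDerivAt_le {a b C : ℝ} {f f' : ℝ → ℝ}
    (hf : ∀ t ∈ Ioo a b, HasDerivAt f (f' t) t) {s t : ℝ}
    (hC : ∀ u ∈ Ioo a b, s ≤ u → f' u ≤ C) (hs : s ∈ Ioo a b) (ht : t ∈ Ioo a b) (hst : s ≤ t) :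
    f t - f s ≤ C * (t - s) := by
  have hsub : Icc s t ⊆ Ioo a b := (ordConnected_Ioo (a := a) (b := b)).out hs ht
  refine (convex_Icc s t).image_sub_le_mul_sub_of_deriv_le
    (fun u hu => (hf u (hsub hu)).continuousAt.continuousWithinAt)
    (fun u hu => (hf u (hsub (interior_subset hu))).differentiableAt.differentiableWithinAt)
    (fun u hu => ?_) s (left_mem_Icc.2 hst) t (right_mem_Icc.2 hst) hst
  have hu' := interior_subset hu
  exact (hf u (hsub hu')).deriv ▸ hC u (hsub hu') hu'.1

/-- A `C¹` function on the unit interval exceeds its mean by at most the `L¹` norm of its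
derivative. -/
theorem le_integral_add_of_abs_deriv_le {f f' g : ℝ → ℝ} (hf : ∀ x, HasDerivAt f (f' x) x)
    (hf' : Continuous f') (hg : Continuous g) (h : ∀ x, |f' x| ≤ g x)
    {x : ℝ} (hx : x ∈ Icc (0 : ℝ) 1) :
    f x ≤ (∫ y in (0 : ℝ)..1, f y) + ∫ y in (0 : ℝ)..1, g y := by
  have hosc : ∀ a ∈ Icc (0 : ℝ) 1, ∀ b ∈ Icc (0 : ℝ) 1, a ≤ b →
      |f b - f a| ≤ ∫ y in (0 : ℝ)..1, g y := by
    intro a ha b hb hab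
    rw [← intervalIntegral.integral_eq_sub_of_hasDerivAt (fun y _ => hf y)
      (hf'.intervalIntegrable a b)]
    calc |∫ y in a..b, f' y| ≤ ∫ y in a..b, |f' y| :=
          intervalIntegral.abs_integral_le_integral_abs hab
      _ ≤ ∫ y in a..b, g y := intervalIntegral.integral_mono hab
          (hf'.abs.intervalIntegrable _ _) (hg.intervalIntegrable _ _) h
      _ ≤ ∫ y in (0 : ℝ)..1, g y := intervalIntegral.integral_mono_interval ha.1 hab hb.2
          (Filter.Eventually.of_forall fun y => (abs_nonneg _).trans (h y))
          (hg.intervalIntegrable _ _)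
  have hcf : Continuous f := continuous_iff_continuousAt.2 fun y => (hf y).continuousAt
  have hpt : ∀ y ∈ Icc (0 : ℝ) 1, f x - (∫ z in (0 : ℝ)..1, g z) ≤ f y := by
    intro y hy
    rcases le_total x y with hxy | hxy
    · linarith [(abs_le.1 (hosc x hx y hy hxy)).1]
    · linarith [(abs_le.1 (hosc y hy x hx hxy)).2]
  have := intervalIntegral.integral_mono_on (μ := volume) zero_le_one intervalIntegrable_const
    (hcf.intervalIntegrable 0 1) hpt
  rw [intervalIntegral.integral_const] at this
  simp only [sub_zero, one_smul] at this
  linarith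

namespace RegularSolution

variable {Λ T : ℝ} (sol : RegularSolution Λ (Ico 1 T)) {t x : ℝ}

/-- The energy density `e^{λ+η} (r + s)`. -/
def energyDensity (t x : ℝ) : ℝ := exp (sol.lam t x + sol.η t x) * (sol.r t x + sol.s t x)

/-- The energy flux `e^{2η} (r - s)`. -/
def energyFlux (t x : ℝ) : ℝ := exp (2 * sol.η t x) * (sol.r t x - sol.s t x)

theorem isOpen_interior_slab : IsOpen (Ioo 1 T ×ˢ (univ : Set ℝ)) := isOpen_Ioo.prod isOpen_univ

theorem interior_slab_subset : Ioo 1 T ×ˢ (univ : Set ℝ) ⊆ Ico 1 T ×ˢ (univ : Set ℝ) :=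
  prod_mono_left Ioo_subset_Ico_self

theorem contDiffOn_energyDensity :
    ContDiffOn ℝ 1 (fun p : ℝ × ℝ => sol.energyDensity p.1 p.2) (Ico 1 T ×ˢ (univ : Set ℝ)) :=
  (sol.lam_c1.add sol.η_c1).exp.mul (sol.r_c1.add sol.s_c1)

theorem contDiffOn_energyFlux :
    ContDiffOn ℝ 1 (fun p : ℝ × ℝ => sol.energyFlux p.1 p.2) (Ico 1 T ×ˢ (univ : Set ℝ)) :=
  (contDiffOn_const.mul sol.η_c1).exp.mul (sol.r_c1.sub sol.s_c1)

theorem energyDensity_nonneg (ht : t ∈ Ico 1 T) : 0 ≤ sol.energyDensity t x :=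
  mul_nonneg (exp_pos _).le (add_nonneg (sol.r_nonneg t ht x) (sol.s_nonneg t ht x))

theorem pderivT_η (ht : t ∈ Ico 1 T) :
    pderivT sol.η t x = 1 / (2 * t) - Λ * t / 2 * exp (2 * sol.η t x)
      + 2 * π * t * exp (2 * sol.η t x) * (sol.r t x + sol.s t x) := by
  have h := sol.eqE2 t ht x
  have ht0 : t ≠ 0 := by linarith [ht.1]
  have he : exp (-2 * sol.η t x) * exp (2 * sol.η t x) = 1 := by
    rw [← exp_add]; simp
  field_simp
  linear_combination exp (2 * sol.η t x) * h - (2 * t * pderivT sol.η t x - 1) * he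

theorem pderivT_lam (ht : t ∈ Ico 1 T) :
    pderivT sol.lam t x = -(1 / (2 * t)) + Λ * t / 2 * exp (2 * sol.η t x)
      + 2 * π * t * exp (2 * sol.η t x) * (sol.r t x + sol.s t x) := by
  have h := sol.eqE1 t ht x
  have ht0 : t ≠ 0 := by linarith [ht.1]
  have he : exp (-2 * sol.η t x) * exp (2 * sol.η t x) = 1 := by
    rw [← exp_add]; simp
  field_simp
  linear_combination exp (2 * sol.η t x) * h - (2 * t * pderivT sol.lam t x + 1) * he

theorem pderivT_energyDensity (ht : t ∈ Ioo 1 T) :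
    pderivT sol.energyDensity t x = -pderivX sol.energyFlux t x
      - (1 / t + Λ * t * exp (2 * sol.η t x)) * sol.energyDensity t x
      - 4 / t * exp (sol.lam t x + sol.η t x) * √(sol.r t x * sol.s t x) := by
  have hmem : (t, x) ∈ Ioo 1 T ×ˢ (univ : Set ℝ) := ⟨ht, mem_univ _⟩
  have ht' := Ioo_subset_Ico_self ht
  have ht0 : t ≠ 0 := by linarith [ht.1]
  have hU := isOpen_interior_slab (T := T)
  have hη := sol.η_c1.mono interior_slab_subset
  have hl := sol.lam_c1.mono interior_slab_subset
  have hr := sol.r_c1.mono interior_slab_subset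
  have hs := sol.s_c1.mono interior_slab_subset
  have hT : pderivT sol.energyDensity t x = _ :=
    (((hasDerivAt_pderivT hU hl hmem).add (hasDerivAt_pderivT hU hη hmem)).exp.mul
      ((hasDerivAt_pderivT hU hr hmem).add (hasDerivAt_pderivT hU hs hmem))).deriv
  have hX : pderivX sol.energyFlux t x = _ :=
    (((hasDerivAt_pderivX hU hη hmem).const_mul 2).exp.mul
      ((hasDerivAt_pderivX hU hr hmem).sub (hasDerivAt_pderivX hU hs hmem))).deriv
  have h4 := sol.eqE4 t ht' x
  have h5 := sol.eqE5 t ht' x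
  have he : exp (sol.lam t x + sol.η t x) * exp (sol.η t x - sol.lam t x)
      = exp (2 * sol.η t x) := by
    rw [← exp_add]; ring_nf
  have hsub : pderivT sol.η t x - pderivT sol.lam t x
      = 1 / t - Λ * t * exp (2 * sol.η t x) := by
    rw [sol.pderivT_η ht', sol.pderivT_lam ht']; field_simp; ring
  simp only [Pi.add_apply, Pi.sub_apply] at hT hX
  rw [hT, hX]
  unfold energyDensity
  linear_combination exp (sol.lam t x + sol.η t x) * (h4 + h5)
    + exp (sol.lam t x + sol.η t x) * (sol.r t x + sol.s t x) * hsub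
    - (pderivX sol.r t x - pderivX sol.s t x
      + 2 * pderivX sol.η t x * (sol.r t x - sol.s t x)) * he

theorem integral_pderivX_energyFlux (ht : t ∈ Ioo 1 T) :
    ∫ x in (0 : ℝ)..1, pderivX sol.energyFlux t x = 0 := by
  have hU := isOpen_interior_slab (T := T)
  have hF := sol.contDiffOn_energyFlux.mono interior_slab_subset
  rw [intervalIntegral.integral_eq_sub_of_hasDerivAt
    (fun y _ => hasDerivAt_pderivX hU hF ⟨ht, mem_univ _⟩)
    ((continuous_slice (F := pderivX sol.energyFlux) (continuousOn_pderivX hU hF)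
      ht).intervalIntegrable _ _)]
  have ht' := Ioo_subset_Ico_self ht
  have h1 := sol.η_per t ht' 0
  have h2 := sol.r_per t ht' 0
  have h3 := sol.s_per t ht' 0
  rw [zero_add] at h1 h2 h3
  simp [energyFlux, h1, h2, h3]

theorem integral_energyDensity_le (hΛ : 0 ≤ Λ) {t₀ : ℝ} (ht₀ : t₀ ∈ Ioo 1 T) (ht : t ∈ Ioo 1 T)
    (h : t₀ ≤ t) :
    ∫ x in (0 : ℝ)..1, sol.energyDensity t x ≤ ∫ x in (0 : ℝ)..1, sol.energyDensity t₀ x := by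
  have hU := isOpen_interior_slab (T := T)
  have hD := sol.contDiffOn_energyDensity.mono interior_slab_subset
  have hF := sol.contDiffOn_energyFlux.mono interior_slab_subset
  have key := sub_le_mul_sub_of_hasDerivAt_le (C := 0)
    (fun τ hτ => hasDerivAt_integral_pderivT isOpen_Ioo hD hτ) ?_ ht₀ ht h
  · linarith
  intro τ hτ _
  have hcT : Continuous (pderivT sol.energyDensity τ) :=
    continuous_slice (continuousOn_pderivT hU hD) hτ
  have hcX : Continuous (pderivX sol.energyFlux τ) :=
    continuous_slice (continuousOn_pderivX hU hF) hτ
  have hmono := intervalIntegral.integral_mono (μ := volume) zero_le_one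
    (hcT.intervalIntegrable 0 1) (hcX.neg.intervalIntegrable 0 1) fun x => by
      have hτ0 : 0 < τ := by linarith [hτ.1]
      have hd := sol.energyDensity_nonneg (x := x) (Ioo_subset_Ico_self hτ)
      rw [sol.pderivT_energyDensity hτ, Pi.neg_apply]
      have h1 : 0 ≤ (1 / τ + Λ * τ * exp (2 * sol.η τ x)) * sol.energyDensity τ x := by positivity
      have h2 : 0 ≤ 4 / τ * exp (sol.lam τ x + sol.η τ x) * √(sol.r τ x * sol.s τ x) := by
        positivity
      linarith
  simpa [sol.integral_pderivX_energyFlux hτ] using hmono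

theorem exists_neg_le_η (hΛ : 0 ≤ Λ) {t₀ M : ℝ} (ht₀ : t₀ ∈ Ioo 1 T)
    (hM : ∀ x, |sol.η t₀ x| ≤ M) :
    ∃ K, ∀ t ∈ Ico t₀ T, ∀ x, -K ≤ sol.η t x := by
  have hU := isOpen_interior_slab (T := T)
  have hη := sol.η_c1.mono interior_slab_subset
  refine ⟨T * exp (2 * M) + Λ * T ^ 2 * T, fun t ht x => ?_⟩
  have ht' : t ∈ Ioo 1 T := ⟨ht₀.1.trans_le ht.1, ht.2⟩
  have key := sub_le_mul_sub_of_hasDerivAt_le (C := Λ * T ^ 2)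
    (fun τ (hτ : τ ∈ Ioo 1 T) => (hasDerivAt_id τ).mul
      ((hasDerivAt_pderivT hU hη ⟨hτ, mem_univ x⟩).const_mul (-2)).exp) ?_ ht₀ ht' ht.1
  · simp only [Pi.mul_apply, id] at key
    have h1 : t₀ * exp (-2 * sol.η t₀ x) ≤ T * exp (2 * M) := by
      have : exp (-2 * sol.η t₀ x) ≤ exp (2 * M) :=
        exp_le_exp.2 (by linarith [(abs_le.1 (hM x)).1])
      have h0 := ht₀.1
      have h2 := ht₀.2
      gcongr
      linarith
    have h2 : Λ * T ^ 2 * (t - t₀) ≤ Λ * T ^ 2 * T := by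
      have := ht.2
      have h0 := ht₀.1
      gcongr
      linarith
    have h3 := add_one_le_exp (-2 * sol.η t x)
    have h4 : exp (-2 * sol.η t x) ≤ t * exp (-2 * sol.η t x) :=
      le_mul_of_one_le_left (exp_pos _).le ht'.1.le
    have h5 : 0 ≤ T * exp (2 * M) + Λ * T ^ 2 * T := by
      have : 0 < T := by linarith [ht'.1, ht'.2]
      positivity
    linarith
  · intro τ hτ _
    have hτ' := Ioo_subset_Ico_self hτ
    have h2 := sol.eqE2 τ hτ' x
    have h3 : 0 ≤ 4 * π * τ ^ 2 * (sol.r τ x + sol.s τ x) :=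
      mul_nonneg (by positivity) (add_nonneg (sol.r_nonneg τ hτ' x) (sol.s_nonneg τ hτ' x))
    have h4 : Λ * τ ^ 2 ≤ Λ * T ^ 2 := by
      have h5 := hτ.1
      have h6 := hτ.2
      gcongr
    simp only [id]
    linarith

theorem η_sub_lam_le (hΛ : 0 ≤ Λ) {t₀ : ℝ} (ht₀ : t₀ ∈ Ioo 1 T) (ht : t ∈ Ico t₀ T) :
    sol.η t x - sol.lam t x ≤ sol.η t₀ x - sol.lam t₀ x + T := by
  have hU := isOpen_interior_slab (T := T)
  have hη := sol.η_c1.mono interior_slab_subset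
  have hl := sol.lam_c1.mono interior_slab_subset
  have ht' : t ∈ Ioo 1 T := ⟨ht₀.1.trans_le ht.1, ht.2⟩
  have key := sub_le_mul_sub_of_hasDerivAt_le (C := 1)
    (fun τ (hτ : τ ∈ Ioo 1 T) => (hasDerivAt_pderivT hU hη ⟨hτ, mem_univ x⟩).sub
      (hasDerivAt_pderivT hU hl ⟨hτ, mem_univ x⟩)) ?_ ht₀ ht' ht.1
  · simp only [Pi.sub_apply] at key
    linarith [ht.2, ht₀.1]
  · intro τ hτ _
    have hτ' := Ioo_subset_Ico_self hτ
    have hτ0 : 0 < τ := by linarith [hτ.1]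
    rw [sol.pderivT_η hτ', sol.pderivT_lam hτ']
    have h1 : 0 ≤ Λ * τ / 2 * exp (2 * sol.η τ x) := by positivity
    have h2 : 1 / (2 * τ) ≤ 1 / 2 := by
      gcongr
      linarith [hτ.1]
    linarith

theorem pderivT_η_le (hΛ : 0 ≤ Λ) (ht : t ∈ Ico 1 T) {B : ℝ}
    (hB : sol.η t x - sol.lam t x ≤ B) :
    pderivT sol.η t x ≤ 1 + 2 * π * T * exp B * sol.energyDensity t x := by
  have ht0 : 0 < t := by linarith [ht.1]
  have he : exp (2 * sol.η t x)
      = exp (sol.η t x - sol.lam t x) * exp (sol.lam t x + sol.η t x) := by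
    rw [← exp_add]; ring_nf
  have h1 : 0 ≤ Λ * t / 2 * exp (2 * sol.η t x) := by positivity
  have h2 : 1 / (2 * t) ≤ 1 := by
    rw [div_le_one (by positivity)]
    linarith [ht.1]
  have h3 : 2 * π * t * exp (2 * sol.η t x) * (sol.r t x + sol.s t x)
      = 2 * π * t * exp (sol.η t x - sol.lam t x) * sol.energyDensity t x := by
    rw [he, energyDensity]; ring
  have h4 : 2 * π * t * exp (sol.η t x - sol.lam t x) * sol.energyDensity t x
      ≤ 2 * π * T * exp B * sol.energyDensity t x := by
    have := sol.energyDensity_nonneg (x := x) ht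
    have htT := ht.2.le
    have hT0 : 0 < T := ht0.trans ht.2
    gcongr
  rw [sol.pderivT_η ht]
  linarith

theorem abs_pderivX_η_le (ht : t ∈ Ico 1 T) :
    |pderivX sol.η t x| ≤ 2 * π * T * sol.energyDensity t x := by
  have hr := sol.r_nonneg t ht x
  have hs := sol.s_nonneg t ht x
  have ht0 : 0 < t := by linarith [ht.1]
  have h : |sol.r t x - sol.s t x| ≤ sol.r t x + sol.s t x :=
    abs_le.2 ⟨by linarith, by linarith⟩
  have htT := ht.2.le
  have hT0 : 0 < T := ht0.trans ht.2
  rw [sol.eqE3 t ht x, abs_neg, abs_mul, abs_of_pos (by positivity), energyDensity, ← mul_assoc]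
  gcongr

theorem exists_η_le (hΛ : 0 ≤ Λ) {t₀ M N : ℝ} (ht₀ : t₀ ∈ Ioo 1 T)
    (hM : ∀ x, |sol.η t₀ x| ≤ M) (hN : ∀ x, |sol.lam t₀ x| ≤ N) :
    ∃ K, ∀ t ∈ Ico t₀ T, ∀ x, sol.η t x ≤ K := by
  have hU := isOpen_interior_slab (T := T)
  have hη := sol.η_c1.mono interior_slab_subset
  have hD := sol.contDiffOn_energyDensity.mono interior_slab_subset
  have hT : 0 < T := by linarith [ht₀.1, ht₀.2]
  set E := ∫ x in (0 : ℝ)..1, sol.energyDensity t₀ x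
  set B := M + N + T
  have hE : 0 ≤ E := intervalIntegral.integral_nonneg zero_le_one
    fun x _ => sol.energyDensity_nonneg (Ioo_subset_Ico_self ht₀)
  have hB : ∀ t ∈ Ico t₀ T, ∀ x, sol.η t x - sol.lam t x ≤ B := fun t ht x => by
    linarith [sol.η_sub_lam_le (x := x) hΛ ht₀ ht, (abs_le.1 (hM x)).2, (abs_le.1 (hN x)).1]
  have hmean : ∀ t ∈ Ico t₀ T,
      ∫ x in (0 : ℝ)..1, sol.η t x ≤ M + (1 + 2 * π * T * exp B * E) * T := by
    intro t ht
    have ht' : t ∈ Ioo 1 T := ⟨ht₀.1.trans_le ht.1, ht.2⟩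
    have key := sub_le_mul_sub_of_hasDerivAt_le (C := 1 + 2 * π * T * exp B * E)
      (fun τ hτ => hasDerivAt_integral_pderivT isOpen_Ioo hη hτ) ?_ ht₀ ht' ht.1
    · have h₀ : ∫ x in (0 : ℝ)..1, sol.η t₀ x ≤ M := by
        have h := intervalIntegral.integral_mono (μ := volume) zero_le_one
          ((continuous_slice hη.continuousOn ht₀).intervalIntegrable 0 1)
          intervalIntegrable_const fun x => (abs_le.1 (hM x)).2
        simpa using h
      have h₁ : (1 + 2 * π * T * exp B * E) * (t - t₀) ≤ (1 + 2 * π * T * exp B * E) * T := by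
        have htT := ht.2
        have h1 := ht₀.1
        gcongr
        linarith
      linarith
    · intro τ hτ hle
      have hc : Continuous (sol.energyDensity τ) := continuous_slice hD.continuousOn hτ
      have hc' : Continuous (pderivT sol.η τ) := continuous_slice (continuousOn_pderivT hU hη) hτ
      calc ∫ x in (0 : ℝ)..1, pderivT sol.η τ x
          ≤ ∫ x in (0 : ℝ)..1, (1 + 2 * π * T * exp B * sol.energyDensity τ x) :=
            intervalIntegral.integral_mono zero_le_one (hc'.intervalIntegrable _ _)
              (Continuous.intervalIntegrable (by fun_prop) _ _)
              fun x => sol.pderivT_η_le hΛ (Ioo_subset_Ico_self hτ) (hB τ ⟨hle, hτ.2⟩ x)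
        _ = 1 + 2 * π * T * exp B * ∫ x in (0 : ℝ)..1, sol.energyDensity τ x := by
            rw [intervalIntegral.integral_add intervalIntegrable_const
              (Continuous.intervalIntegrable (by fun_prop) _ _),
              intervalIntegral.integral_const_mul]
            simp
        _ ≤ 1 + 2 * π * T * exp B * E := by
            gcongr
            exact sol.integral_energyDensity_le hΛ ht₀ hτ hle
  refine ⟨M + (1 + 2 * π * T * exp B * E) * T + 2 * π * T * E, fun t ht x => ?_⟩
  have ht' : t ∈ Ioo 1 T := ⟨ht₀.1.trans_le ht.1, ht.2⟩
  have hc : Continuous (sol.energyDensity t) := continuous_slice hD.continuousOn ht'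
  have h := le_integral_add_of_abs_deriv_le
    (fun y => hasDerivAt_pderivX hU hη ⟨ht', mem_univ y⟩)
    (continuous_slice (continuousOn_pderivX hU hη) ht')
    (g := fun y => 2 * π * T * sol.energyDensity t y) (by fun_prop)
    (fun y => sol.abs_pderivX_η_le (Ioo_subset_Ico_self ht'))
    ⟨Int.fract_nonneg x, (Int.fract_lt_one x).le⟩
  rw [apply_fract_of_periodic (sol.η_per t (Ioo_subset_Ico_self ht')),
    intervalIntegral.integral_const_mul] at h
  have hEt : 2 * π * T * ∫ y in (0 : ℝ)..1, sol.energyDensity t y ≤ 2 * π * T * E := by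
    gcongr
    exact sol.integral_energyDensity_le hΛ ht₀ ht' ht.1
  linarith [hmean t ht]

end RegularSolution

/-- Boundedness of `η` on finite time intervals (Lemma 4.3). -/
theorem eta_bounded (Λ : ℝ) (hΛ : 0 < Λ) (T : ℝ) (hT : 1 < T)
    (sol : RegularSolution Λ (Set.Ico 1 T)) :
    ∃ M : ℝ, ∀ t ∈ Set.Ico (1:ℝ) T, ∀ x : ℝ, |sol.η t x| ≤ M := by
  obtain ⟨t₀, ht₀⟩ := exists_between hT
  have hsub : Icc 1 t₀ ⊆ Ico 1 T := Icc_subset_Ico_right ht₀.2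
  obtain ⟨M, hM⟩ := exists_abs_le_of_periodic isCompact_Icc
    (sol.η_c1.continuousOn.mono (prod_mono_left hsub)) fun t ht => sol.η_per t (hsub ht)
  obtain ⟨N, hN⟩ := exists_abs_le_of_periodic isCompact_Icc
    (sol.lam_c1.continuousOn.mono (prod_mono_left hsub)) fun t ht => sol.lam_per t (hsub ht)
  have hmem : t₀ ∈ Icc 1 t₀ := right_mem_Icc.2 ht₀.1.le
  obtain ⟨K, hK⟩ := sol.exists_neg_le_η hΛ.le ht₀ (hM t₀ hmem)
  obtain ⟨L, hL⟩ := sol.exists_η_le hΛ.le ht₀ (hM t₀ hmem) (hN t₀ hmem)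
  refine ⟨max M (max K L), fun t ht x => ?_⟩
  rcases le_total t t₀ with h | h
  · exact (hM t ⟨ht.1, h⟩ x).trans (le_max_left _ _)
  · refine le_trans ?_ (le_max_right _ _)
    have h1 := hK t ⟨h, ht.2⟩ x
    have h2 := hL t ⟨h, ht.2⟩ x
    exact abs_le.2 ⟨by linarith [le_max_left K L], h2.trans (le_max_right K L)⟩
end
end

section
/- (Late-time asymptotics of the lapse.) Let (η, λ, r, s) be a regular solution on [1,∞). Then there exists a constant C > 0 such that for every t ≥ 1 and every x ∈ ℝ: |e^{η(t,x)} − √(3/Λ)·t^{−1}| ≤ C t^{−2}. -/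
open Real Set MeasureTheory

noncomputable section

/-- A one-sided version of Fermat's rule: a maximum from the left forces a nonnegative derivative. -/
theorem HasDerivAt.nonneg_of_le_left {f : ℝ → ℝ} {f' a b : ℝ} (hab : a < b)
    (hf : HasDerivAt f f' b) (hmax : ∀ y ∈ Ioo a b, f y ≤ f b) : 0 ≤ f' := by
  have h1 : Filter.Tendsto (slope f b) (nhdsWithin b (Iio b)) (nhds f') :=
    hf.tendsto_slope.mono_left (nhdsWithin_mono _ fun y hy => ne_of_lt hy)
  refine ge_of_tendsto h1 ?_
  filter_upwards [Ioo_mem_nhdsLT hab] with y hy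
  rw [slope_def_field]
  exact div_nonneg_of_nonpos (by linarith [hmax y hy]) (by linarith [hy.2])

/-- A continuous function that is 1-periodic in space attains its maximum over a compact time
interval `[1, T]`. -/
theorem exists_max_of_periodic {u : ℝ → ℝ → ℝ}
    (hu : ContinuousOn (fun p : ℝ × ℝ => u p.1 p.2) (Ici 1 ×ˢ univ))
    (hper : ∀ t ∈ Ici (1 : ℝ), ∀ x, u t (x + 1) = u t x) {T : ℝ} (hT : 1 ≤ T) :
    ∃ t₀ ∈ Icc 1 T, ∃ x₀, ∀ t ∈ Icc 1 T, ∀ x, u t x ≤ u t₀ x₀ := by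
  have hK : IsCompact (Icc (1 : ℝ) T ×ˢ Icc (0 : ℝ) 1) := isCompact_Icc.prod isCompact_Icc
  obtain ⟨⟨t₀, x₀⟩, h₀, hmax⟩ := hK.exists_isMaxOn
    ⟨(1, 0), ⟨⟨le_rfl, hT⟩, ⟨le_rfl, zero_le_one⟩⟩⟩
    (hu.mono (prod_mono (fun t ht => ht.1) (subset_univ _)))
  refine ⟨t₀, h₀.1, x₀, fun t ht x => ?_⟩
  obtain ⟨y, hy, hxy⟩ :=
    Function.Periodic.exists_mem_Ico₀ (f := u t) (hper t ht.1) zero_lt_one x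
  rw [hxy]
  exact isMaxOn_iff.1 hmax (t, y) ⟨ht, Ico_subset_Icc_self hy⟩

/-- Maximum principle for the transport inequality `∂ₜu + a ∂ₓu ≤ 0` on a spatial circle. -/
theorem exists_bound_of_transport_nonpos {u a : ℝ → ℝ → ℝ}
    (hu : ContinuousOn (fun p : ℝ × ℝ => u p.1 p.2) (Ici 1 ×ˢ univ))
    (hper : ∀ t ∈ Ici (1 : ℝ), ∀ x, u t (x + 1) = u t x)
    (hdiff : ∀ t, 1 < t → ∀ x, DifferentiableAt ℝ (fun τ => u τ x) t)
    (htr : ∀ t, 1 < t → ∀ x, pderivT u t x + a t x * pderivX u t x ≤ 0) :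
    ∃ M, ∀ t, 1 ≤ t → ∀ x, u t x ≤ M := by
  obtain ⟨t₁, ht₁, x₁, hM⟩ := exists_max_of_periodic hu hper (le_refl (1 : ℝ))
  refine ⟨u t₁ x₁, fun T hT x => ?_⟩
  have key : ∀ ε > 0, u T x - ε * (T - 1) ≤ u t₁ x₁ := by
    intro ε hε
    obtain ⟨t₀, ht₀, x₀, hmax⟩ := exists_max_of_periodic
      (u := fun t x => u t x - ε * (t - 1)) (by fun_prop)
      (fun t ht x => by simp only [hper t ht x]) hT
    refine (hmax T ⟨hT, le_rfl⟩ x).trans ?_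
    rcases eq_or_lt_of_le ht₀.1 with h | h
    · have := hM t₀ ⟨ht₀.1, h.ge⟩ x₀
      rw [← h] at this ⊢
      simpa using this
    · exfalso
      have hx : pderivX u t₀ x₀ = 0 := by
        refine IsLocalMax.deriv_eq_zero (Filter.Eventually.of_forall fun y => ?_)
        have := hmax t₀ ht₀ y
        simpa using this
      have hd : HasDerivAt (fun τ => u τ x₀ - ε * (τ - 1)) (pderivT u t₀ x₀ - ε * 1) t₀ :=
        (hdiff t₀ h x₀).hasDerivAt.sub (((hasDerivAt_id t₀).sub_const 1).const_mul ε)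
      have h1 := hd.nonneg_of_le_left h fun y hy => hmax y ⟨hy.1.le, hy.2.le.trans ht₀.2⟩ x₀
      have h2 := htr t₀ h x₀
      rw [hx] at h2
      linarith
  have hlim : Filter.Tendsto (fun ε : ℝ => u T x - ε * (T - 1)) (nhdsWithin 0 (Ioi 0))
      (nhds (u T x)) := by
    have : Continuous fun ε : ℝ => u T x - ε * (T - 1) := by fun_prop
    simpa using (this.tendsto 0).mono_left nhdsWithin_le_nhds
  refine le_of_tendsto hlim ?_
  filter_upwards [self_mem_nhdsWithin] with ε hε using key ε hε

theorem differentiableAt_time_of_contDiffOn {f : ℝ → ℝ → ℝ}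
    (hf : ContDiffOn ℝ 1 (fun p : ℝ × ℝ => f p.1 p.2) (Ici 1 ×ˢ univ)) {t : ℝ} (ht : 1 < t)
    (x : ℝ) : DifferentiableAt ℝ (fun τ => f τ x) t := by
  have h : DifferentiableAt ℝ (fun p : ℝ × ℝ => f p.1 p.2) (t, x) :=
    (hf.contDiffAt (prod_mem_nhds (Ici_mem_nhds ht) Filter.univ_mem)).differentiableAt one_ne_zero
  exact DifferentiableAt.comp (f := fun τ : ℝ => (τ, x)) t h (by fun_prop)

/-- A density which decays at least like `1 / t` along its characteristics is `O(1 / t)`. -/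
theorem exists_bound_mul_of_transport {f a : ℝ → ℝ → ℝ}
    (hf : ContDiffOn ℝ 1 (fun p : ℝ × ℝ => f p.1 p.2) (Ici 1 ×ˢ univ))
    (hper : ∀ t ∈ Ici (1 : ℝ), ∀ x, f t (x + 1) = f t x)
    (htr : ∀ t, 1 < t → ∀ x, pderivT f t x + a t x * pderivX f t x ≤ -(f t x / t)) :
    ∃ M, ∀ t, 1 ≤ t → ∀ x, t * f t x ≤ M := by
  refine exists_bound_of_transport_nonpos (a := a) (u := fun t x => t * f t x)
    (continuousOn_fst.mul hf.continuousOn) (fun t ht x => by simp only [hper t ht x])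
    (fun t ht x => differentiableAt_id.mul (differentiableAt_time_of_contDiffOn hf ht x))
    (fun t ht x => ?_)
  have hT : pderivT (fun t x => t * f t x) t x = 1 * f t x + t * pderivT f t x :=
    ((hasDerivAt_id t).mul (differentiableAt_time_of_contDiffOn hf ht x).hasDerivAt).deriv
  have hX : pderivX (fun t x => t * f t x) t x = t * pderivX f t x := by
    simp [pderivX]
  have ht0 : 0 < t := by linarith
  have := mul_le_mul_of_nonneg_left (htr t ht x) ht0.le
  rw [mul_neg, mul_div_cancel₀ _ ht0.ne'] at this
  rw [hT, hX]
  linarith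

namespace RegularSolution

variable {Λ : ℝ}

theorem transport_r_le (hΛ : 0 < Λ) (sol : RegularSolution Λ (Ici 1)) {t : ℝ} (ht : 1 ≤ t)
    (x : ℝ) : pderivT sol.r t x + exp (sol.η t x - sol.lam t x) * pderivX sol.r t x
      ≤ -(sol.r t x / t) := by
  have ht0 : 0 < t := by linarith
  have hr := sol.r_nonneg t ht x
  have hs := sol.s_nonneg t ht x
  have h1 := sol.eqE1 t ht x
  rw [sol.eqE4 t ht x, sol.eqE3 t ht x]
  have e1 : exp (sol.η t x - sol.lam t x) * exp (sol.lam t x + sol.η t x)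
      = exp (2 * sol.η t x) := by rw [← exp_add]; ring_nf
  have e2 : exp (2 * sol.η t x) * exp (-2 * sol.η t x) = 1 := by rw [← exp_add]; simp
  have e0 := exp_pos (2 * sol.η t x)
  set E := exp (2 * sol.η t x)
  have hlam : pderivT sol.lam t x =
      -(1 / (2 * t)) + E * (Λ * t / 2 + 2 * π * t * (sol.r t x + sol.s t x)) := by
    have h2 : 2 * t * pderivT sol.lam t x + 1
        = E * (Λ * t ^ 2 + 4 * π * t ^ 2 * (sol.r t x + sol.s t x)) := by
      linear_combination E * h1 - (2 * t * pderivT sol.lam t x + 1) * e2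
    field_simp
    linear_combination h2
  have hsq : 0 ≤ 2 / t * √(sol.r t x * sol.s t x) := by positivity
  have hpos : 0 ≤ E * (Λ * t + 8 * π * t * sol.s t x) * sol.r t x := by positivity
  have : -2 * (pderivT sol.lam t x + exp (sol.η t x - sol.lam t x) *
      -(2 * π * t * exp (sol.lam t x + sol.η t x) * (sol.r t x - sol.s t x)) + 1 / t) * sol.r t x
      = -(sol.r t x / t) - E * (Λ * t + 8 * π * t * sol.s t x) * sol.r t x := by
    rw [hlam]
    field_simp
    linear_combination (4 * π * t ^ 2 * (sol.r t x - sol.s t x) * sol.r t x) * e1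
  linarith

/-- Spatial reflection `x ↦ -x` exchanges the two fluid variables; in particular `s` obeys the
same decay inequality as `r`, along the other family of characteristics. -/
theorem transport_s_le (hΛ : 0 < Λ) (sol : RegularSolution Λ (Ici 1)) {t : ℝ} (ht : 1 ≤ t)
    (x : ℝ) : pderivT sol.s t x + -exp (sol.η t x - sol.lam t x) * pderivX sol.s t x
      ≤ -(sol.s t x / t) := by
  have ht0 : 0 < t := by linarith
  have hr := sol.r_nonneg t ht x
  have hs := sol.s_nonneg t ht x
  have h1 := sol.eqE1 t ht x
  rw [neg_mul, ← sub_eq_add_neg, sol.eqE5 t ht x, sol.eqE3 t ht x]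
  have e1 : exp (sol.η t x - sol.lam t x) * exp (sol.lam t x + sol.η t x)
      = exp (2 * sol.η t x) := by rw [← exp_add]; ring_nf
  have e2 : exp (2 * sol.η t x) * exp (-2 * sol.η t x) = 1 := by rw [← exp_add]; simp
  have e0 := exp_pos (2 * sol.η t x)
  set E := exp (2 * sol.η t x)
  have hlam : pderivT sol.lam t x =
      -(1 / (2 * t)) + E * (Λ * t / 2 + 2 * π * t * (sol.r t x + sol.s t x)) := by
    have h2 : 2 * t * pderivT sol.lam t x + 1
        = E * (Λ * t ^ 2 + 4 * π * t ^ 2 * (sol.r t x + sol.s t x)) := by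
      linear_combination E * h1 - (2 * t * pderivT sol.lam t x + 1) * e2
    field_simp
    linear_combination h2
  have hsq : 0 ≤ 2 / t * √(sol.r t x * sol.s t x) := by positivity
  have hpos : 0 ≤ E * (Λ * t + 8 * π * t * sol.r t x) * sol.s t x := by positivity
  have : -2 * (pderivT sol.lam t x - exp (sol.η t x - sol.lam t x) *
      -(2 * π * t * exp (sol.lam t x + sol.η t x) * (sol.r t x - sol.s t x)) + 1 / t) * sol.s t x
      = -(sol.s t x / t) - E * (Λ * t + 8 * π * t * sol.r t x) * sol.s t x := by
    rw [hlam]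
    field_simp
    linear_combination -(4 * π * t ^ 2 * (sol.r t x - sol.s t x) * sol.s t x) * e1
  linarith

/-- The fluid density `r + s` is `O(1 / t)`. -/
theorem exists_density_bound (hΛ : 0 < Λ) (sol : RegularSolution Λ (Ici 1)) :
    ∃ M, ∀ t, 1 ≤ t → ∀ x, t * (sol.r t x + sol.s t x) ≤ M := by
  obtain ⟨A, hA⟩ := exists_bound_mul_of_transport sol.r_c1 sol.r_per
    fun t ht x => sol.transport_r_le hΛ ht.le x
  obtain ⟨B, hB⟩ := exists_bound_mul_of_transport
    (a := fun t x => -exp (sol.η t x - sol.lam t x)) sol.s_c1 sol.s_per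
    fun t ht x => sol.transport_s_le hΛ ht.le x
  exact ⟨A + B, fun t ht x => by rw [mul_add]; exact add_le_add (hA t ht x) (hB t ht x)⟩

theorem hasDerivAt_mul_exp (sol : RegularSolution Λ (Ici 1)) {t : ℝ} (ht : 1 < t) (x : ℝ) :
    HasDerivAt (fun τ => τ * exp (-2 * sol.η τ x))
      (Λ * t ^ 2 - 4 * π * t ^ 2 * (sol.r t x + sol.s t x)) t := by
  have hη : HasDerivAt (fun τ => sol.η τ x) (pderivT sol.η t x) t :=
    (differentiableAt_time_of_contDiffOn sol.η_c1 ht x).hasDerivAt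
  have h := (hasDerivAt_id t).mul (hη.const_mul (-2)).exp
  refine h.congr_deriv ?_
  have h2 := sol.eqE2 t ht.le x
  simp only [id]
  linear_combination -h2

/-- `e^{-2η}` agrees with `Λ t² / 3` up to an error that is linear in `t`. -/
theorem exists_abs_exp_sub_le (hΛ : 0 < Λ) (sol : RegularSolution Λ (Ici 1)) :
    ∃ K, 0 < K ∧ ∀ t, 1 ≤ t → ∀ x, |exp (-2 * sol.η t x) - Λ * t ^ 2 / 3| ≤ K * t := by
  obtain ⟨M, hM⟩ := sol.exists_density_bound hΛ
  have hM0 : 0 ≤ M := le_trans (by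
    have := sol.r_nonneg 1 (mem_Ici.2 le_rfl) 0
    have := sol.s_nonneg 1 (mem_Ici.2 le_rfl) 0
    positivity) (hM 1 le_rfl 0)
  have hcont : ContinuousOn (fun p : ℝ × ℝ => exp (-2 * sol.η p.1 p.2)) (Ici 1 ×ˢ univ) :=
    (sol.η_c1.continuousOn.const_smul (-2 : ℝ)).rexp
  obtain ⟨t₁, -, x₁, hB⟩ := exists_max_of_periodic (u := fun t x => exp (-2 * sol.η t x)) hcont
    (fun t ht x => by simp only [sol.η_per t ht x]) (le_refl (1 : ℝ))
  set B := exp (-2 * sol.η t₁ x₁)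
  have hB0 : 0 < B := exp_pos _
  refine ⟨B + 2 * π * M + Λ / 3, by positivity, fun t ht x => ?_⟩
  have hg : ContinuousOn (fun τ => τ * exp (-2 * sol.η τ x)) (Ici 1) :=
    continuousOn_id.mul (hcont.comp (f := fun τ : ℝ => (τ, x)) (by fun_prop)
      fun τ hτ => ⟨hτ, mem_univ _⟩)
  have hcube (τ : ℝ) : HasDerivAt (fun τ : ℝ => Λ * τ ^ 3 / 3) (Λ * τ ^ 2) τ :=
    (((hasDerivAt_pow 3 τ).const_mul Λ).div_const 3).congr_deriv (by push_cast; ring)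
  have hsquare (τ : ℝ) : HasDerivAt (fun τ : ℝ => 2 * π * M * τ ^ 2) (4 * π * M * τ) τ :=
    ((hasDerivAt_pow 2 τ).const_mul (2 * π * M)).congr_deriv (by push_cast; ring)
  have hanti : AntitoneOn (fun τ => τ * exp (-2 * sol.η τ x) - Λ * τ ^ 3 / 3) (Ici 1) := by
    refine antitoneOn_of_hasDerivWithinAt_nonpos (convex_Ici 1) (hg.sub (by fun_prop))
      (fun τ hτ => ((sol.hasDerivAt_mul_exp (by simpa using hτ) x).sub
        (hcube τ)).hasDerivWithinAt) fun τ hτ => ?_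
    rw [interior_Ici] at hτ
    have := sol.r_nonneg τ (mem_Ici.2 hτ.le) x
    have := sol.s_nonneg τ (mem_Ici.2 hτ.le) x
    have : 0 ≤ 4 * π * τ ^ 2 * (sol.r τ x + sol.s τ x) := by positivity
    linarith
  have hmono : MonotoneOn (fun τ => τ * exp (-2 * sol.η τ x) - Λ * τ ^ 3 / 3
      + 2 * π * M * τ ^ 2) (Ici 1) := by
    refine monotoneOn_of_hasDerivWithinAt_nonneg (convex_Ici 1)
      ((hg.sub (by fun_prop)).add (by fun_prop))
      (fun τ hτ => (((sol.hasDerivAt_mul_exp (by simpa using hτ) x).sub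
        (hcube τ)).add (hsquare τ)).hasDerivWithinAt) fun τ hτ => ?_
    rw [interior_Ici] at hτ
    have hτ0 : 0 < τ := lt_trans one_pos hτ
    have : 0 ≤ 4 * π * τ := by positivity
    have := mul_le_mul_of_nonneg_left (hM τ hτ.le x) this
    linarith
  have h1 := hanti (mem_Ici.2 le_rfl) (mem_Ici.2 ht) ht
  have h2 := hmono (mem_Ici.2 le_rfl) (mem_Ici.2 ht) ht
  have h3 := hB 1 ⟨le_rfl, le_rfl⟩ x
  have h4 := exp_pos (-2 * sol.η 1 x)
  simp only at h1 h2 h3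
  have ht0 : 0 < t := by linarith
  have ht2 : 1 ≤ t ^ 2 := one_le_pow₀ ht
  have hπM : 0 ≤ 2 * π * M := by positivity
  have p1 : B ≤ B * t ^ 2 := le_mul_of_one_le_right hB0.le ht2
  have p2 : Λ / 3 ≤ Λ / 3 * t ^ 2 := le_mul_of_one_le_right (by positivity) ht2
  have p3 : 0 ≤ 2 * π * M * t ^ 2 := by positivity
  rw [abs_le]
  constructor
  · refine le_of_mul_le_mul_left ?_ ht0
    linarith
  · refine le_of_mul_le_mul_left ?_ ht0
    linarith

/-- `e^{-2η}` grows at least quadratically. -/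
theorem exists_mul_sq_le_exp (hΛ : 0 < Λ) (sol : RegularSolution Λ (Ici 1)) :
    ∃ κ, 0 < κ ∧ ∀ t, 1 ≤ t → ∀ x, κ * t ^ 2 ≤ exp (-2 * sol.η t x) := by
  obtain ⟨K, hK, hKt⟩ := sol.exists_abs_exp_sub_le hΛ
  set T := max 1 (6 * K / Λ)
  have hT1 : 1 ≤ T := le_max_left _ _
  have hT0 : 0 < T := by linarith
  obtain ⟨t₁, -, x₁, hN⟩ := exists_max_of_periodic sol.η_c1.continuousOn sol.η_per hT1
  have hm : 0 < exp (-2 * sol.η t₁ x₁) := exp_pos _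
  refine ⟨min (Λ / 6) (exp (-2 * sol.η t₁ x₁) / T ^ 2), by positivity, fun t ht x => ?_⟩
  rcases le_total t T with h | h
  · calc min (Λ / 6) (exp (-2 * sol.η t₁ x₁) / T ^ 2) * t ^ 2
        ≤ exp (-2 * sol.η t₁ x₁) / T ^ 2 * T ^ 2 := by
          gcongr
          exact min_le_right _ _
      _ = exp (-2 * sol.η t₁ x₁) := by field_simp
      _ ≤ exp (-2 * sol.η t x) := exp_le_exp.2 (by linarith [hN t ⟨ht, h⟩ x])
  · have h1 : 6 * K / Λ ≤ t := (le_max_right _ _).trans h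
    rw [div_le_iff₀ hΛ] at h1
    have h2 := (abs_le.1 (hKt t ht x)).1
    have h3 : min (Λ / 6) (exp (-2 * sol.η t₁ x₁) / T ^ 2) * t ^ 2 ≤ Λ / 6 * t ^ 2 := by
      gcongr
      exact min_le_left _ _
    have h4 := mul_le_mul_of_nonneg_right h1 (by linarith : (0 : ℝ) ≤ t)
    linarith

end RegularSolution

/-- Late-time asymptotics of the lapse. -/
theorem lapse_asymptotics (Λ : ℝ) (hΛ : 0 < Λ)
    (sol : RegularSolution Λ (Set.Ici 1)) :
    ∃ C : ℝ, 0 < C ∧ ∀ t : ℝ, 1 ≤ t → ∀ x : ℝ,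
      |Real.exp (sol.η t x) - Real.sqrt (3 / Λ) / t| ≤ C / t ^ 2 := by
  obtain ⟨K, hK, hKt⟩ := sol.exists_abs_exp_sub_le hΛ
  obtain ⟨κ, hκ, hκt⟩ := sol.exists_mul_sq_le_exp hΛ
  have hL : 0 < √(3 / Λ) := by positivity
  have hLsq : √(3 / Λ) ^ 2 * Λ = 3 := by
    rw [sq_sqrt (by positivity)]
    field_simp
  set L := √(3 / Λ)
  refine ⟨K * L / κ, by positivity, fun t ht x => ?_⟩
  have ht0 : 0 < t := by linarith
  have h1 := hKt t ht x
  have h2 := hκt t ht x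
  have he := exp_pos (sol.η t x)
  have hew : exp (sol.η t x) ^ 2 * exp (-2 * sol.η t x) = 1 := by
    rw [← exp_nat_mul, ← exp_add]
    simp
  set e := exp (sol.η t x)
  set w := exp (-2 * sol.η t x)
  have hq : 0 < L / t := by positivity
  have hqw : (L / t) ^ 2 * (Λ * t ^ 2 / 3) = 1 := by
    field_simp
    linarith
  set q := L / t with hqdef
  have hsplit : (e - q) * (e + q) = -(e ^ 2 * q ^ 2 * (w - Λ * t ^ 2 / 3)) := by
    linear_combination q ^ 2 * hew - e ^ 2 * hqw
  have habs : |e - q| * (e + q) ≤ e ^ 2 * q ^ 2 * (K * t) := by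
    rw [← abs_of_pos (add_pos he hq), ← abs_mul, hsplit, abs_neg, abs_mul,
      abs_of_pos (by positivity : 0 < e ^ 2 * q ^ 2)]
    gcongr
  have he2 : e ^ 2 * (κ * t ^ 2) ≤ 1 := by
    rw [← hew]
    gcongr
  have h3 : |e - q| * q ≤ (e ^ 2 * (K * t * q)) * q := by
    have : 0 ≤ |e - q| * e := by positivity
    linarith
  have h4 := le_of_mul_le_mul_right h3 hq
  have h5 : K * t * q = K * L := by
    rw [hqdef]
    field_simp
  rw [h5] at h4
  refine h4.trans ?_
  rw [div_div, le_div_iff₀ (by positivity)]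
  calc e ^ 2 * (K * L) * (κ * t ^ 2) = K * L * (e ^ 2 * (κ * t ^ 2)) := by ring
    _ ≤ K * L * 1 := by gcongr
    _ = K * L := mul_one _
end
end

section
/- (Late-time asymptotics of ∂ₜλ, Theorem 4.1.) Let (η, λ, r, s) be a regular solution on [1,∞). Then there exists a constant C > 0 such that for every t ≥ 1 and every x ∈ ℝ: |∂ₜλ(t,x) − 1/t| ≤ C t^{−2}. -/
open Real Set MeasureTheory

noncomputable section

open Filter Topology

/-- A continuous function that is periodic in space is bounded on bounded time intervals. -/
lemma exists_bound_of_periodic {f : ℝ → ℝ → ℝ} {J : Set ℝ}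
    (hc : ContinuousOn (fun p : ℝ × ℝ => f p.1 p.2) (J ×ˢ (Set.univ : Set ℝ)))
    (hper : ∀ t ∈ J, ∀ x : ℝ, f t (x + 1) = f t x) {I : Set ℝ} (hI : IsCompact I) (hIJ : I ⊆ J) :
    ∃ M : ℝ, 0 ≤ M ∧ ∀ t ∈ I, ∀ x : ℝ, |f t x| ≤ M := by
  have hK : IsCompact (I ×ˢ Set.Icc (0 : ℝ) 1) := hI.prod isCompact_Icc
  obtain ⟨M, hM⟩ := hK.exists_bound_of_continuousOn
    (hc.mono (Set.prod_mono hIJ (Set.subset_univ _)))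
  refine ⟨|M|, abs_nonneg M, fun t ht x => ?_⟩
  have hp : Function.Periodic (f t) 1 := hper t (hIJ ht)
  obtain ⟨y, hy, hxy⟩ := hp.exists_mem_Ico₀ one_pos x
  rw [hxy]
  exact (hM (t, y) ⟨ht, Set.Ico_subset_Icc_self hy⟩).trans (le_abs_self M)

/-- At a right endpoint where a function is maximal, its derivative is nonnegative. -/
lemma HasDerivAt.nonneg_of_forall_Icc_le {g : ℝ → ℝ} {a b d : ℝ} (hab : a < b)
    (hg : HasDerivAt g d b) (hmax : ∀ τ ∈ Set.Icc a b, g τ ≤ g b) : 0 ≤ d := by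
  have hs : Tendsto (slope g b) (𝓝[<] b) (𝓝 d) :=
    hasDerivWithinAt_iff_tendsto_slope' (by simp) |>.1 (hg.hasDerivWithinAt (s := Set.Iio b))
  refine ge_of_tendsto hs ?_
  filter_upwards [Ioo_mem_nhdsLT hab] with τ hτ
  rw [slope_def_field]
  exact div_nonneg_of_nonpos (sub_nonpos.2 (hmax τ ⟨hτ.1.le, hτ.2.le⟩)) (sub_nonpos.2 hτ.2.le)

/-- Maximum principle: a spatially periodic function that does not increase in time at its
spatial critical points stays below its initial bound. -/
lemma le_of_forall_pderivX_eq_zero {w : ℝ → ℝ → ℝ} {M : ℝ}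
    (hc : ContinuousOn (fun p : ℝ × ℝ => w p.1 p.2) (Set.Ici 1 ×ˢ (Set.univ : Set ℝ)))
    (hper : ∀ t ∈ Set.Ici (1 : ℝ), ∀ x : ℝ, w t (x + 1) = w t x)
    (hd : ∀ t, 1 < t → ∀ x, pderivX w t x = 0 → ∃ d ≤ 0, HasDerivAt (fun τ => w τ x) d t)
    (hinit : ∀ x, w 1 x ≤ M) {t : ℝ} (ht : 1 ≤ t) (x : ℝ) : w t x ≤ M := by
  by_contra! hlt
  obtain ⟨ε, hε, hεt⟩ : ∃ ε > 0, ε * (t - 1) < w t x - M := by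
    refine ⟨(w t x - M) / (t + 1), div_pos (by linarith) (by linarith), ?_⟩
    rw [div_mul_eq_mul_div, div_lt_iff₀ (by linarith)]
    nlinarith
  have hK : IsCompact (Set.Icc 1 t ×ˢ Set.Icc (0 : ℝ) 1) := isCompact_Icc.prod isCompact_Icc
  have hφc : ContinuousOn (fun p : ℝ × ℝ => w p.1 p.2 - ε * (p.1 - 1))
      (Set.Icc 1 t ×ˢ Set.Icc (0 : ℝ) 1) :=
    (hc.mono (Set.prod_mono Set.Icc_subset_Ici_self (Set.subset_univ _))).sub
      (by fun_prop)
  obtain ⟨⟨t₁, x₁⟩, ⟨ht₁, -⟩, hmax⟩ :=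
    hK.exists_isMaxOn ⟨(1, 0), ⟨by simp [ht], by simp⟩⟩ hφc
  have hmax' : ∀ τ ∈ Set.Icc 1 t, ∀ y, w τ y - ε * (τ - 1) ≤ w t₁ x₁ - ε * (t₁ - 1) := by
    intro τ hτ y
    have hp : Function.Periodic (w τ) 1 := hper τ hτ.1
    obtain ⟨z, hz, hyz⟩ := hp.exists_mem_Ico₀ one_pos y
    rw [hyz]
    exact hmax (Set.mk_mem_prod hτ (Set.Ico_subset_Icc_self hz))
  have htx := hmax' t ⟨ht, le_rfl⟩ x
  have ht₁' : 1 < t₁ := by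
    refine lt_of_le_of_ne ht₁.1 fun h => ?_
    have := hinit x₁
    subst h
    linarith
  have hcrit : pderivX w t₁ x₁ = 0 := by
    refine IsLocalMax.deriv_eq_zero (Eventually.of_forall fun y => ?_)
    have := hmax' t₁ ht₁ y
    linarith
  obtain ⟨d, hd0, hd1⟩ := hd t₁ ht₁' x₁ hcrit
  have hder : HasDerivAt (fun τ => w τ x₁ - ε * (τ - 1)) (d - ε * 1) t₁ :=
    hd1.sub (((hasDerivAt_id t₁).sub_const 1).const_mul ε)
  have := hder.nonneg_of_forall_Icc_le ht₁' fun τ hτ => hmax' τ ⟨hτ.1, hτ.2.trans ht₁.2⟩ x₁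
  linarith

/-- A `C¹` function on the slab has its partial time derivative at interior times. -/
lemma ContDiffOn.hasDerivAt_pderivT {f : ℝ → ℝ → ℝ}
    (hf : ContDiffOn ℝ 1 (fun p : ℝ × ℝ => f p.1 p.2) (Set.Ici 1 ×ˢ (Set.univ : Set ℝ)))
    {t : ℝ} (ht : 1 < t) (x : ℝ) : HasDerivAt (fun τ => f τ x) (pderivT f t x) t := by
  have hn : Set.Ici (1 : ℝ) ×ˢ (Set.univ : Set ℝ) ∈ 𝓝 (t, x) :=
    prod_mem_nhds (Ici_mem_nhds ht) univ_mem
  have h : DifferentiableAt ℝ (fun p : ℝ × ℝ => f p.1 p.2) (t, x) :=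
    (hf.contDiffAt hn).differentiableAt (by simp)
  have h2 : DifferentiableAt ℝ (fun τ : ℝ => (τ, x)) t := by fun_prop
  exact (DifferentiableAt.comp t h h2).hasDerivAt

/-- A continuous function on the slab is continuous in time at each space point. -/
lemma ContinuousOn.slice_left {f : ℝ → ℝ → ℝ} {J : Set ℝ}
    (hf : ContinuousOn (fun p : ℝ × ℝ => f p.1 p.2) (J ×ˢ (Set.univ : Set ℝ))) (x : ℝ) :
    ContinuousOn (fun τ => f τ x) J :=
  hf.comp (f := fun τ : ℝ => (τ, x)) (by fun_prop) fun _ hτ => ⟨hτ, Set.mem_univ _⟩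

/-- Decay like `t⁻⁴` for a nonnegative, spatially periodic function obeying a damped transport
inequality with a damping rate controlled by `A`. -/
lemma exists_decay_of_transport {f A : ℝ → ℝ → ℝ} {Λ K : ℝ} (hΛ : 0 < Λ) (hK : 0 ≤ K)
    (hf : ContDiffOn ℝ 1 (fun p : ℝ × ℝ => f p.1 p.2) (Set.Ici 1 ×ˢ (Set.univ : Set ℝ)))
    (hper : ∀ t ∈ Set.Ici (1 : ℝ), ∀ x : ℝ, f t (x + 1) = f t x)
    (hf0 : ∀ t ∈ Set.Ici (1 : ℝ), ∀ x : ℝ, 0 ≤ f t x)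
    (hA0 : ∀ t x, 0 < A t x)
    (hA : ∀ t, 1 ≤ t → ∀ x, t * A t x ≤ Λ * t ^ 3 / 3 + K)
    (htr : ∀ t, 1 < t → ∀ x, pderivX f t x = 0 →
      t * A t x * pderivT f t x ≤ -(Λ * t ^ 2 + A t x) * f t x) :
    ∃ D : ℝ, 0 ≤ D ∧ ∀ t, 1 ≤ t → ∀ x, t ^ 4 * f t x ≤ D := by
  obtain ⟨M, hM0, hM⟩ := exists_bound_of_periodic hf.continuousOn hper
    (isCompact_singleton (x := (1 : ℝ))) (by simp)
  have key : ∀ t, 1 ≤ t → ∀ x, t * (Λ * t ^ 3 + 3 * K) * f t x ≤ (Λ + 3 * K) * M := by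
    intro t ht x
    refine le_of_forall_pderivX_eq_zero (w := fun t x => t * (Λ * t ^ 3 + 3 * K) * f t x)
      ?_ ?_ ?_ ?_ ht x
    · exact ContinuousOn.mul (by fun_prop) hf.continuousOn
    · intro τ hτ y
      simp only [hper τ hτ y]
    · intro τ hτ y hcrit
      have hτ0 : 0 < τ := by linarith
      have hP : 0 < τ * (Λ * τ ^ 3 + 3 * K) := by positivity
      have hcrit' : pderivX f τ y = 0 := by
        have : pderivX (fun t x => t * (Λ * t ^ 3 + 3 * K) * f t x) τ y
            = τ * (Λ * τ ^ 3 + 3 * K) * pderivX f τ y := by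
          simp only [pderivX, deriv_const_mul_field]
        rw [this] at hcrit
        exact (mul_eq_zero.1 hcrit).resolve_left hP.ne'
      have hPd : HasDerivAt (fun t : ℝ => t * (Λ * t ^ 3 + 3 * K))
          (4 * Λ * τ ^ 3 + 3 * K) τ := by
        have h := (hasDerivAt_id τ).mul (((hasDerivAt_pow 3 τ).const_mul Λ).add_const (3 * K))
        refine h.congr_deriv ?_
        simp only [id, Nat.cast_ofNat]
        ring
      refine ⟨_, ?_, hPd.mul (hf.hasDerivAt_pderivT hτ y)⟩
      have h1 := mul_le_mul_of_nonneg_left (htr τ hτ y hcrit') hP.le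
      have h2 : 0 ≤ f τ y * (Λ * τ ^ 3) * (Λ * τ ^ 3 / 3 + K - τ * A τ y) :=
        mul_nonneg (mul_nonneg (hf0 τ hτ.le y) (by positivity)) (sub_nonneg.2 (hA τ hτ.le y))
      have h3 : 0 < τ * A τ y := mul_pos hτ0 (hA0 τ y)
      refine nonpos_of_mul_nonpos_right ?_ h3
      nlinarith
    · intro y
      have := (le_abs_self _).trans (hM 1 rfl y)
      have h : 0 ≤ Λ + 3 * K := by positivity
      simpa using mul_le_mul_of_nonneg_left this h
  refine ⟨(Λ + 3 * K) * M / Λ, by positivity, fun t ht x => ?_⟩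
  rw [le_div_iff₀ hΛ]
  have h1 := key t ht x
  have h2 : 0 ≤ 3 * K * t * f t x := mul_nonneg (by positivity) (hf0 t ht x)
  nlinarith

namespace RegularSolution

variable {Λ : ℝ} (sol : RegularSolution Λ (Set.Ici 1))

lemma hasDerivAt_mul_exp_neg_two_eta {t : ℝ} (ht : 1 < t) (x : ℝ) :
    HasDerivAt (fun τ => τ * Real.exp (-2 * sol.η τ x) - Λ * τ ^ 3 / 3)
      (-(4 * Real.pi * t ^ 2 * (sol.r t x + sol.s t x))) t := by
  have hη := sol.η_c1.hasDerivAt_pderivT ht x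
  have h := ((hasDerivAt_id t).mul (hη.const_mul (-2)).exp).sub
    (((hasDerivAt_pow 3 t).const_mul Λ).div_const 3)
  refine h.congr_deriv ?_
  have := sol.eqE2 t ht.le x
  simp only [id, Nat.cast_ofNat]
  linear_combination -this

lemma continuousOn_mul_exp_neg_two_eta (x : ℝ) :
    ContinuousOn (fun τ => τ * Real.exp (-2 * sol.η τ x) - Λ * τ ^ 3 / 3) (Set.Ici 1) := by
  have := sol.η_c1.continuousOn.slice_left x
  fun_prop

lemma exists_mul_exp_neg_two_eta_le :
    ∃ K : ℝ, 0 ≤ K ∧ ∀ t, 1 ≤ t → ∀ x,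
      t * Real.exp (-2 * sol.η t x) ≤ Λ * t ^ 3 / 3 + K := by
  obtain ⟨M, hM0, hM⟩ := exists_bound_of_periodic sol.η_c1.continuousOn sol.η_per
    (isCompact_singleton (x := (1 : ℝ))) (by simp)
  refine ⟨Real.exp (2 * M) + |Λ / 3|, by positivity, fun t ht x => ?_⟩
  have hanti : AntitoneOn (fun τ => τ * Real.exp (-2 * sol.η τ x) - Λ * τ ^ 3 / 3)
      (Set.Ici 1) := by
    refine antitoneOn_of_hasDerivWithinAt_nonpos (convex_Ici 1)
      (sol.continuousOn_mul_exp_neg_two_eta x)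
      (f' := fun t => -(4 * Real.pi * t ^ 2 * (sol.r t x + sol.s t x))) ?_ ?_
    · intro τ hτ
      rw [interior_Ici] at hτ
      exact (sol.hasDerivAt_mul_exp_neg_two_eta hτ x).hasDerivWithinAt
    · intro τ hτ
      rw [interior_Ici] at hτ
      have hr := sol.r_nonneg τ (Set.mem_Ioi.1 hτ).le x
      have hs := sol.s_nonneg τ (Set.mem_Ioi.1 hτ).le x
      have : 0 ≤ 4 * Real.pi * τ ^ 2 * (sol.r τ x + sol.s τ x) := by positivity
      linarith
  have h := hanti Set.self_mem_Ici (Set.mem_Ici.2 ht) ht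
  have h1 : Real.exp (-2 * sol.η 1 x) ≤ Real.exp (2 * M) := by
    have := (neg_abs_le _).trans' (neg_le_neg (hM 1 rfl x))
    exact Real.exp_le_exp.2 (by linarith)
  have h2 := neg_abs_le (Λ / 3)
  simp only [one_mul, one_pow, mul_one] at h
  linarith

lemma exists_r_decay (hΛ : 0 < Λ) : ∃ D : ℝ, 0 ≤ D ∧ ∀ t, 1 ≤ t → ∀ x, t ^ 4 * sol.r t x ≤ D := by
  obtain ⟨K, hK0, hK⟩ := sol.exists_mul_exp_neg_two_eta_le
  refine exists_decay_of_transport hΛ hK0 sol.r_c1 sol.r_per sol.r_nonneg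
    (A := fun t x => Real.exp (-2 * sol.η t x)) (fun _ _ => Real.exp_pos _) hK ?_
  intro t ht x hx
  have ht0 : 0 < t := by linarith
  have e1 := sol.eqE1 t ht.le x
  have e3 := sol.eqE3 t ht.le x
  have e4 := sol.eqE4 t ht.le x
  have hr := sol.r_nonneg t ht.le x
  have hs := sol.s_nonneg t ht.le x
  have hexp : Real.exp (-2 * sol.η t x) * Real.exp (sol.η t x - sol.lam t x)
      * Real.exp (sol.lam t x + sol.η t x) = 1 := by
    rw [← Real.exp_add, ← Real.exp_add, Real.exp_eq_one_iff]; ring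
  rw [hx, e3] at e4
  have hq := Real.sqrt_nonneg (sol.r t x * sol.s t x)
  have hA := Real.exp_pos (-2 * sol.η t x)
  generalize Real.sqrt (sol.r t x * sol.s t x) = q at *
  generalize Real.exp (-2 * sol.η t x) = A at *
  generalize Real.exp (sol.η t x - sol.lam t x) = E at *
  generalize Real.exp (sol.lam t x + sol.η t x) = F at *
  generalize sol.r t x = r at *
  generalize sol.s t x = s at *
  have : t * A * pderivT sol.r t x
      = -(Λ * t ^ 2 + 8 * Real.pi * t ^ 2 * s + A) * r - 2 * A * q := by
    field_simp at e4
    linear_combination A * e4 - r * e1 + 4 * Real.pi * t ^ 2 * (r - s) * r * hexp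
  have h1 : 0 ≤ 8 * Real.pi * t ^ 2 * s * r := by positivity
  have h2 : 0 ≤ A * q := by positivity
  rw [this]
  linarith

lemma exists_s_decay (hΛ : 0 < Λ) : ∃ D : ℝ, 0 ≤ D ∧ ∀ t, 1 ≤ t → ∀ x, t ^ 4 * sol.s t x ≤ D := by
  obtain ⟨K, hK0, hK⟩ := sol.exists_mul_exp_neg_two_eta_le
  refine exists_decay_of_transport hΛ hK0 sol.s_c1 sol.s_per sol.s_nonneg
    (A := fun t x => Real.exp (-2 * sol.η t x)) (fun _ _ => Real.exp_pos _) hK ?_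
  intro t ht x hx
  have ht0 : 0 < t := by linarith
  have e1 := sol.eqE1 t ht.le x
  have e3 := sol.eqE3 t ht.le x
  have e5 := sol.eqE5 t ht.le x
  have hr := sol.r_nonneg t ht.le x
  have hs := sol.s_nonneg t ht.le x
  have hexp : Real.exp (-2 * sol.η t x) * Real.exp (sol.η t x - sol.lam t x)
      * Real.exp (sol.lam t x + sol.η t x) = 1 := by
    rw [← Real.exp_add, ← Real.exp_add, Real.exp_eq_one_iff]; ring
  rw [hx, e3] at e5
  have hq := Real.sqrt_nonneg (sol.r t x * sol.s t x)
  have hA := Real.exp_pos (-2 * sol.η t x)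
  generalize Real.sqrt (sol.r t x * sol.s t x) = q at *
  generalize Real.exp (-2 * sol.η t x) = A at *
  generalize Real.exp (sol.η t x - sol.lam t x) = E at *
  generalize Real.exp (sol.lam t x + sol.η t x) = F at *
  generalize sol.r t x = r at *
  generalize sol.s t x = s at *
  have : t * A * pderivT sol.s t x
      = -(Λ * t ^ 2 + 8 * Real.pi * t ^ 2 * r + A) * s - 2 * A * q := by
    field_simp at e5
    linear_combination A * e5 - s * e1 - 4 * Real.pi * t ^ 2 * (r - s) * s * hexp
  have h1 : 0 ≤ 8 * Real.pi * t ^ 2 * r * s := by positivity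
  have h2 : 0 ≤ A * q := by positivity
  rw [this]
  linarith

/-- The energy density term in (E1) and (E2) decays like `t⁻²`. -/
lemma exists_density_decay (hΛ : 0 < Λ) :
    ∃ D : ℝ, 0 ≤ D ∧ ∀ t, 1 ≤ t → ∀ x,
      4 * Real.pi * t ^ 2 * (sol.r t x + sol.s t x) ≤ D / t ^ 2 := by
  obtain ⟨D₁, hD₁, h₁⟩ := sol.exists_r_decay hΛ
  obtain ⟨D₂, hD₂, h₂⟩ := sol.exists_s_decay hΛ
  refine ⟨4 * Real.pi * (D₁ + D₂), by positivity, fun t ht x => ?_⟩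
  have ht0 : 0 < t := by linarith
  rw [le_div_iff₀ (by positivity)]
  calc _ = 4 * Real.pi * (t ^ 4 * sol.r t x + t ^ 4 * sol.s t x) := by ring
    _ ≤ _ := by gcongr <;> simp [h₁ t ht x, h₂ t ht x]

lemma exists_le_mul_exp_neg_two_eta (hΛ : 0 < Λ) :
    ∃ K : ℝ, 0 ≤ K ∧ ∀ t, 1 ≤ t → ∀ x,
      Λ * t ^ 3 / 3 - K ≤ t * Real.exp (-2 * sol.η t x) := by
  obtain ⟨D, hD0, hD⟩ := sol.exists_density_decay hΛ
  refine ⟨Λ / 3 + D, by positivity, fun t ht x => ?_⟩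
  have hmono : MonotoneOn
      (fun τ => (τ * Real.exp (-2 * sol.η τ x) - Λ * τ ^ 3 / 3) - D * τ⁻¹) (Set.Ici 1) := by
    refine monotoneOn_of_hasDerivWithinAt_nonneg (convex_Ici 1)
      ((sol.continuousOn_mul_exp_neg_two_eta x).sub
        (continuousOn_const.mul (continuousOn_inv₀.mono ?_)))
      (f' := fun t => -(4 * Real.pi * t ^ 2 * (sol.r t x + sol.s t x)) - D * (-(t ^ 2)⁻¹)) ?_ ?_
    · intro τ hτ
      have : (1 : ℝ) ≤ τ := hτ
      exact (by linarith : (0 : ℝ) < τ).ne'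
    · intro τ hτ
      rw [interior_Ici] at hτ
      have : (1 : ℝ) < τ := hτ
      exact ((sol.hasDerivAt_mul_exp_neg_two_eta hτ x).sub
        ((hasDerivAt_inv (by linarith : (0 : ℝ) < τ).ne').const_mul D)).hasDerivWithinAt
    · intro τ hτ
      rw [interior_Ici] at hτ
      have := hD τ (Set.mem_Ioi.1 hτ).le x
      rw [div_eq_mul_inv] at this
      linarith
  have h := hmono Set.self_mem_Ici (Set.mem_Ici.2 ht) ht
  have h1 := Real.exp_pos (-2 * sol.η 1 x)
  have h2 : 0 ≤ D * t⁻¹ := by positivity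
  simp only [one_mul, one_pow, mul_one, inv_one] at h
  linarith

lemma exists_exp_two_eta_le (hΛ : 0 < Λ) :
    ∃ B : ℝ, 0 < B ∧ ∀ t, 1 ≤ t → ∀ x, Real.exp (2 * sol.η t x) ≤ B := by
  obtain ⟨K, hK0, hK⟩ := sol.exists_le_mul_exp_neg_two_eta hΛ
  obtain ⟨M, hM0, hM⟩ := exists_bound_of_periodic sol.η_c1.continuousOn sol.η_per
    (isCompact_Icc (a := (1 : ℝ)) (b := 1 + 3 * (K + 1) / Λ)) Set.Icc_subset_Ici_self
  refine ⟨Real.exp (2 * M), Real.exp_pos _, fun t ht x => Real.exp_le_exp.2 ?_⟩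
  by_cases hle : t ≤ 1 + 3 * (K + 1) / Λ
  · have := (le_abs_self _).trans (hM t ⟨ht, hle⟩ x)
    linarith
  · push Not at hle
    have h1 : 3 * (K + 1) < Λ * t := by
      have : 3 * (K + 1) / Λ < t := by linarith
      rw [div_lt_iff₀ hΛ] at this
      linarith
    have h2 : 1 ≤ Real.exp (-2 * sol.η t x) := by
      have h3 := hK t ht x
      have ht2 : t ≤ t ^ 2 := by nlinarith
      have h4 : t * (K + 1) ≤ Λ * t ^ 3 / 3 := by nlinarith
      have h5 : t * 1 ≤ t * Real.exp (-2 * sol.η t x) := by nlinarith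
      exact le_of_mul_le_mul_left h5 (by linarith)
    have := Real.one_le_exp_iff.1 h2
    linarith

end RegularSolution

/-- Late-time asymptotics of `∂ₜλ` (Theorem 4.1). -/
theorem lambda_t_asymptotics (Λ : ℝ) (hΛ : 0 < Λ)
    (sol : RegularSolution Λ (Set.Ici 1)) :
    ∃ C : ℝ, 0 < C ∧ ∀ t : ℝ, 1 ≤ t → ∀ x : ℝ,
      |pderivT sol.lam t x - 1 / t| ≤ C / t ^ 2 := by
  obtain ⟨D, hD0, hD⟩ := sol.exists_density_decay hΛ
  obtain ⟨K₁, hK₁0, hK₁⟩ := sol.exists_mul_exp_neg_two_eta_le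
  obtain ⟨K₂, hK₂0, hK₂⟩ := sol.exists_le_mul_exp_neg_two_eta hΛ
  obtain ⟨B, hB0, hB⟩ := sol.exists_exp_two_eta_le hΛ
  refine ⟨B * (3 * (K₁ + K₂) + D + 1), by positivity, fun t ht x => ?_⟩
  have ht0 : 0 < t := by linarith
  have e1 := sol.eqE1 t ht x
  have hd := hD t ht x
  have hd0 : 0 ≤ 4 * Real.pi * t ^ 2 * (sol.r t x + sol.s t x) := by
    have hr := sol.r_nonneg t ht x
    have hs := sol.s_nonneg t ht x
    positivity
  have hu := hK₁ t ht x
  have hl := hK₂ t ht x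
  have hb := hB t ht x
  have hE0 := Real.exp_pos (2 * sol.η t x)
  have hEA : Real.exp (2 * sol.η t x) * Real.exp (-2 * sol.η t x) = 1 := by
    rw [← Real.exp_add, Real.exp_eq_one_iff]; ring
  generalize 4 * Real.pi * t ^ 2 * (sol.r t x + sol.s t x) = ρ at *
  generalize Real.exp (-2 * sol.η t x) = A at *
  generalize Real.exp (2 * sol.η t x) = E at *
  have hform : pderivT sol.lam t x - 1 / t
      = E * (Λ * t ^ 3 - 3 * (t * A) + t * ρ) / (2 * t ^ 2) := by
    field_simp
    linear_combination E * e1 - (2 * t * pderivT sol.lam t x - 2) * hEA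
  have htρ : t * ρ ≤ D := by
    rw [le_div_iff₀ (by positivity)] at hd
    nlinarith [mul_nonneg ht0.le hd0]
  have htρ0 : 0 ≤ t * ρ := mul_nonneg ht0.le hd0
  have hnum : |Λ * t ^ 3 - 3 * (t * A) + t * ρ| ≤ 3 * (K₁ + K₂) + D + 1 :=
    abs_le.2 ⟨by linarith, by linarith⟩
  rw [hform, abs_div, abs_mul, abs_of_pos hE0, abs_of_pos (by positivity : 0 < 2 * t ^ 2)]
  gcongr
  linarith [sq_nonneg t]
end
end
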